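/- arXiv:2209.13571 — 2 statements merged into one kernel-verified Lean document; each statement's English description precedes it below -/
import Mathlib

section
/- Fix 0 < a ≤ b. There exist constants A > 0 and N₀ ∈ ℕ, depending only on a and b, such that for every N ≥ N₀, every probability measure μ ∈ M_{a,b,N⁻¹} on 𝕋^N, every g ∈ O_{N⁻¹}(𝕋^N) and every ε > 0: μ({x : |g(x) − 𝔼_μ[g]| ≥ ε}) ≤ 2·exp(−ε²·N/(1 + A·N⁻¹)²). -/
open MeasureTheory Filter Topology Set

noncomputable section

instance fact_zero_lt_one_real : Fact ((0:ℝ) < 1) := ⟨one_pos⟩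

/-- The circle `𝕋 = ℝ/ℤ`. -/
abbrev 𝕋 : Type := AddCircle (1 : ℝ)

/-- Canonical representative of a point of the circle, in `[0,1)`. -/
def rep (t : 𝕋) : ℝ := ((AddCircle.equivIco 1 0 t : Set.Ico (0:ℝ) (0 + 1)) : ℝ)

/-- The lift of a function on the circle to a `1`-periodic function on `ℝ`. -/
def lift1 (ψ : 𝕋 → ℝ) : ℝ → ℝ := fun x => ψ (x : 𝕋)

/-- The cone `V_a` of positive `C²` functions on `𝕋` with `|ψ'| < a·ψ`. -/
def Vcone (a : ℝ) : Set (𝕋 → ℝ) :=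
  {ψ | ContDiff ℝ 2 (lift1 ψ) ∧ (∀ x : 𝕋, 0 < ψ x) ∧
    ∀ x : ℝ, |deriv (lift1 ψ) x| < a * lift1 ψ x}

/-- `β_a(ψ₁,ψ₂) = inf {t > 0 : t·ψ₁ - ψ₂ ∈ V_a}`. -/
def betaH (a : ℝ) (ψ₁ ψ₂ : 𝕋 → ℝ) : ℝ :=
  sInf {t : ℝ | 0 < t ∧ (fun x => t * ψ₁ x - ψ₂ x) ∈ Vcone a}

/-- The Hilbert projective (pseudo)metric of the cone `V_a`. -/
def thetaH (a : ℝ) (ψ₁ ψ₂ : 𝕋 → ℝ) : ℝ :=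
  Real.log (betaH a ψ₁ ψ₂) + Real.log (betaH a ψ₂ ψ₁)

/-- θ_{b}-diameter of `V_c` inside `V_b`. -/
def coneDiam (b c : ℝ) : ℝ :=
  sSup {d : ℝ | ∃ ψ₁ ∈ Vcone c, ∃ ψ₂ ∈ Vcone c, d = thetaH b ψ₁ ψ₂}

section Multi

variable {ι : Type} [Fintype ι] [DecidableEq ι]

/-- Lift of a function on `𝕋^ι` to a function on `ℝ^ι`, periodic in each coordinate. -/
def liftN (ρ : (ι → 𝕋) → ℝ) : (ι → ℝ) → ℝ := fun x => ρ (fun i => (x i : 𝕋))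

/-- Partial derivative in the `i`-th coordinate direction. -/
def pd (i : ι) (f : (ι → ℝ) → ℝ) : (ι → ℝ) → ℝ :=
  fun x => fderiv ℝ f x (Pi.single i 1)

/-- Conditional density of the density `ρ` along the `i`-th coordinate, over the
configuration `x` of the remaining coordinates. -/
def condDens (ρ : (ι → 𝕋) → ℝ) (i : ι) (x : ι → 𝕋) : 𝕋 → ℝ :=
  fun t => ρ (Function.update x i t) / ∫ s : 𝕋, ρ (Function.update x i s)

/-- Membership in `M^{(i,k)}_{a,b,L}`, expressed on densities. -/
def MemMik (a b L : ℝ) (i k : ι) (ρ : (ι → 𝕋) → ℝ) : Prop :=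
  (∀ x : ι → 𝕋, condDens ρ i x ∈ Vcone a) ∧
  ∀ (x : ι → 𝕋) (t : 𝕋),
    thetaH b (condDens ρ i x) (condDens ρ i (Function.update x k t)) ≤ L * dist (x k) t

/-- Membership in `M^{(i)}_{a,b,L}`. -/
def MemMi (a b L : ℝ) (i : ι) (ρ : (ι → 𝕋) → ℝ) : Prop :=
  ∀ k, k ≠ i → MemMik a b L i k ρ

/-- Membership in `M_{a,b,L}`. -/
def MemM (a b L : ℝ) (ρ : (ι → 𝕋) → ℝ) : Prop :=
  ∀ i, MemMi a b L i ρ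

/-- `ρ` is a positive `C²` function on the torus. -/
def IsC2Density (ρ : (ι → 𝕋) → ℝ) : Prop :=
  ContDiff ℝ 2 (liftN ρ) ∧ ∀ x, 0 < ρ x

/-- The bound `|∂_i∂_j ρ / ρ| ≤ α` defining the class `C²_α`. -/
def MemC2 (α : ℝ) (ρ : (ι → 𝕋) → ℝ) : Prop :=
  ∀ (i j : ι) (x : ι → ℝ), |pd i (pd j (liftN ρ)) x| ≤ α * liftN ρ x

/-- `μ` is absolutely continuous with density `ρ`. -/
def HasDensity (μ : Measure (ι → 𝕋)) (ρ : (ι → 𝕋) → ℝ) : Prop :=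
  μ = volume.withDensity (fun x => ENNReal.ofReal (ρ x))

/-- The measure class `M_{a,b,L}` (with positive `C²` density). -/
def InMMeas (a b L : ℝ) (μ : Measure (ι → 𝕋)) : Prop :=
  ∃ ρ, HasDensity μ ρ ∧ IsC2Density ρ ∧ MemM a b L ρ

/-- The measure class `M^{(i)}_{a,b,L}` (with positive `C²` density). -/
def InMiMeas (a b L : ℝ) (i : ι) (μ : Measure (ι → 𝕋)) : Prop :=
  ∃ ρ, HasDensity μ ρ ∧ IsC2Density ρ ∧ MemMi a b L i ρ

/-- The measure class `M_{a,b,L} ∩ C²_α`. -/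
def InMC2 (a b L α : ℝ) (μ : Measure (ι → 𝕋)) : Prop :=
  ∃ ρ, HasDensity μ ρ ∧ IsC2Density ρ ∧ MemM a b L ρ ∧ MemC2 α ρ

/-- Marginal `Π_i μ` on the `i`-th coordinate. -/
def margin (i : ι) (μ : Measure (ι → 𝕋)) : Measure 𝕋 :=
  Measure.map (fun x => x i) μ

/-- Marginal `Π̂_i μ` on the coordinates different from `i`. -/
def marginHat (i : ι) (μ : Measure (ι → 𝕋)) : Measure ({j : ι // j ≠ i} → 𝕋) :=
  Measure.map (fun x (j : {j : ι // j ≠ i}) => x (j : ι)) μ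

/-- Density of the marginal on the `i`-th coordinate. -/
def margDens (ρ : (ι → 𝕋) → ℝ) (i : ι) : 𝕋 → ℝ :=
  fun t => ∫ y : ι → 𝕋, ρ (Function.update y i t)

/-- Oscillation in each coordinate bounded by `α` (the class `O_α`). -/
def OscBdd (α : ℝ) (g : (ι → 𝕋) → ℝ) : Prop :=
  Integrable g volume ∧
    ∀ (j : ι) (x : ι → 𝕋) (t : 𝕋), |g x - g (Function.update x j t)| ≤ α

/-- `ψ` depends only on coordinates outside `s`. -/
def DependsOutside (s : Finset ι) (ψ : (ι → 𝕋) → ℝ) : Prop :=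
  ∀ x y : ι → 𝕋, (∀ j, j ∉ s → x j = y j) → ψ x = ψ y

/-- Replace the coordinates in `s` of `y` by those of `x`. -/
def patch (s : Finset ι) (x y : ι → 𝕋) : ι → 𝕋 :=
  fun j => if j ∈ s then x j else y j

/-- The average of `g` with respect to the conditional measure of the measure with density
`ρ`, given the coordinates in `s` (equal to those of `x`). -/
def condAvg (ρ : (ι → 𝕋) → ℝ) (s : Finset ι) (g : (ι → 𝕋) → ℝ) (x : ι → 𝕋) : ℝ :=
  (∫ y : ι → 𝕋, g (patch s x y) * ρ (patch s x y)) / ∫ y : ι → 𝕋, ρ (patch s x y)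

/-- The fiber (leaf) over `x` of the foliation along the `i`-th coordinate. -/
def fiber (i : ι) (x : ι → 𝕋) : Set (ι → 𝕋) :=
  {z | ∀ j, j ≠ i → z j = x j}

/-- The loop `t ↦ (t; x̂_i)` through the `i`-th coordinate. -/
def coordLoop (i : ι) (y : ι → 𝕋) : C(𝕋, ι → 𝕋) :=
  ⟨fun t => Function.update y i t, by
    apply continuous_pi
    intro j
    simp only [Function.update_apply]
    split_ifs with h
    · subst h; exact continuous_id
    · exact continuous_const⟩

end Multi

/-- Total variation distance between two (finite) measures. -/
def tvDist {X : Type*} [MeasurableSpace X] (μ ν : Measure X) : ℝ :=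
  ⨆ s : {s : Set X // MeasurableSet s}, |(μ (s : Set X)).toReal - (ν (s : Set X)).toReal|

/-! ### Globally coupled maps -/

/-- The data (lifts of the uncoupled maps and of the interactions) of a system of `N`
globally coupled maps. -/
structure CoupledData (N : ℕ) where
  f : Fin N → ℝ → ℝ
  h : Fin N → Fin N → ℝ → ℝ → ℝ

/-- The lift of the coupled map: `F_i(x) = f_i(x_i) + N⁻¹ Σ_j h_{ij}(x_i,x_j)`. -/
def CoupledData.liftMap {N : ℕ} (D : CoupledData N) (x : Fin N → ℝ) (i : Fin N) : ℝ :=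
  D.f i (x i) + (1 / (N : ℝ)) * ∑ j, D.h i j (x i) (x j)

/-- `F : 𝕋^N → 𝕋^N` is the coupled map determined by the data `D`. -/
def CoupledData.IsLiftOf {N : ℕ} (D : CoupledData N) (F : (Fin N → 𝕋) → Fin N → 𝕋) : Prop :=
  ∀ x : Fin N → ℝ, F (fun i => (x i : 𝕋)) = fun i => ((D.liftMap x i : ℝ) : 𝕋)

/-- Assumption (F) with datum `(κ, K, E)`. -/
def AssumptionF {N : ℕ} (κ K E : ℝ) (D : CoupledData N) : Prop :=
  1 < κ - E ∧
  (∀ i, ContDiff ℝ 3 (D.f i)) ∧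
  (∀ i j, ContDiff ℝ 3 (fun p : ℝ × ℝ => D.h i j p.1 p.2)) ∧
  (∀ i (x : ℝ), ((D.f i (x + 1) : ℝ) : 𝕋) = ((D.f i x : ℝ) : 𝕋)) ∧
  (∀ i j (x y : ℝ), D.h i j (x + 1) y = D.h i j x y ∧ D.h i j x (y + 1) = D.h i j x y) ∧
  (∀ i j (n : ℕ), n ≤ 3 → ∀ p : ℝ × ℝ,
      ‖iteratedFDeriv ℝ n (fun q : ℝ × ℝ => D.h i j q.1 q.2) p‖ ≤ E) ∧
  (∀ i (x : ℝ), |iteratedDeriv 2 (D.f i) x| ≤ K) ∧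
  (∀ i (x : ℝ), |iteratedDeriv 3 (D.f i) x| ≤ K) ∧
  (∀ i (x : ℝ), κ < |deriv (D.f i) x|)

/-- Lift of the mean-field map `F_{μ,i}`. -/
def meanFieldLift {N : ℕ} (D : CoupledData N) (μ : Measure (Fin N → 𝕋)) (i : Fin N)
    (x : ℝ) : ℝ :=
  D.f i x + (1 / (N : ℝ)) *
    ∫ y : Fin N → 𝕋, (∑ j, D.h i j x (if j = i then x else rep (y j))) ∂μ

/-- The mean-field (product) map `F_μ`. -/
def meanFieldMap {N : ℕ} (D : CoupledData N) (μ : Measure (Fin N → 𝕋)) :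
    (Fin N → 𝕋) → Fin N → 𝕋 :=
  fun x i => ((meanFieldLift D μ i (rep (x i)) : ℝ) : 𝕋)

/-- The self-consistent transfer operator `𝓕 μ = (F_μ)_* μ`. -/
def STO {N : ℕ} (D : CoupledData N) (μ : Measure (Fin N → 𝕋)) : Measure (Fin N → 𝕋) :=
  Measure.map (meanFieldMap D μ) μ

/-! ### Maps satisfying Assumptions (H1), (H2) -/

/-- `HL` is a lift of the torus map `H`. -/
def IsLiftMap {N : ℕ} (HL : (Fin N → ℝ) → Fin N → ℝ) (H : (Fin N → 𝕋) → Fin N → 𝕋) : Prop :=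
  ∀ x : Fin N → ℝ, H (fun i => (x i : 𝕋)) = fun i => ((HL x i : ℝ) : 𝕋)

/-- Assumption (H1) with datum `(κ, E)`. -/
def AssumptionH1 {N : ℕ} (κ E : ℝ) (HL : (Fin N → ℝ) → Fin N → ℝ) : Prop :=
  1 < κ - E ∧ ContDiff ℝ 1 HL ∧
  (∀ (i : Fin N) (x : Fin N → ℝ), κ < |pd i (fun y => HL y i) x|) ∧
  (∀ (i j : Fin N), j ≠ i → ∀ x, |pd j (fun y => HL y i) x| < E / (N : ℝ))

/-- Assumption (H2) with datum `(K, E)`. -/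
def AssumptionH2 {N : ℕ} (K E : ℝ) (HL : (Fin N → ℝ) → Fin N → ℝ) : Prop :=
  ContDiff ℝ 3 HL ∧
  (∀ (i : Fin N) (x : Fin N → ℝ), |pd i (pd i (fun y => HL y i)) x| ≤ K) ∧
  (∀ (i j k : Fin N), j ≠ i → ∀ x, |pd k (pd j (fun y => HL y i)) x| ≤ E / (N : ℝ)) ∧
  (∀ (i j k : Fin N), j ≠ i → k ≠ i → k ≠ j →
    ∀ x, |pd k (pd j (fun y => HL y i)) x| ≤ E / ((N : ℝ) ^ 2)) ∧
  (∀ (j l : Fin N), l ≠ j → ∀ x, |pd l (pd j (pd j (fun y => HL y j))) x| ≤ E / (N : ℝ)) ∧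
  (∀ (j k l : Fin N), l ≠ j → k ≠ j → l ≠ k →
    ∀ x, |pd l (pd k (pd j (fun y => HL y j))) x| ≤ E / ((N : ℝ) ^ 2))

/-- The straightening diffeomorphism `Φ_i` associated with `H` (with lift `ΦL`). -/
def IsStraightening {N : ℕ} (i : Fin N) (H Φ : (Fin N → 𝕋) → Fin N → 𝕋)
    (ΦL : (Fin N → ℝ) → Fin N → ℝ) : Prop :=
  Function.Bijective Φ ∧ Continuous Φ ∧ ContDiff ℝ 1 ΦL ∧ IsLiftMap ΦL Φ ∧
  (∀ x : Fin N → 𝕋, Φ x i = x i) ∧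
  (∀ x : Fin N → ℝ, ΦL x i = x i) ∧
  (∀ x : Fin N → 𝕋, ∀ j, j ≠ i → H (Φ x) j = H (Function.update x i (0 : 𝕋)) j) ∧
  (∀ x : Fin N → 𝕋, Φ (Function.update x i (0 : 𝕋)) = Function.update x i (0 : 𝕋))

/-- The Jacobian matrix of a lift `HL` at `x`. -/
def Jmat {N : ℕ} (HL : (Fin N → ℝ) → Fin N → ℝ) (x : Fin N → ℝ) :
    Matrix (Fin N) (Fin N) ℝ :=
  fun i j => pd j (fun y => HL y i) x

/-- The absolute value of the Jacobian determinant of a lift `ΦL`, as a function on `𝕋^N`. -/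
def jacDet {N : ℕ} (ΦL : (Fin N → ℝ) → Fin N → ℝ) : (Fin N → 𝕋) → ℝ :=
  fun x => |(fderiv ℝ ΦL (fun j => rep (x j))).det|

end



open ProbabilityTheory in
lemma cov_bound {Ω : Type*} [MeasurableSpace Ω] (P : Measure Ω) [IsProbabilityMeasure P]
    (F H : Ω → ℝ) (hF : Measurable F) (hH : Measurable H) (a₁ b₁ a₂ b₂ : ℝ)
    (h₁ : ∀ x, F x ∈ Icc a₁ b₁) (h₂ : ∀ x, H x ∈ Icc a₂ b₂) :
    |∫ x, F x * H x ∂P - (∫ x, F x ∂P) * ∫ x, H x ∂P| ≤ (b₁ - a₁) * (b₂ - a₂) / 4 := by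
  have mF : MemLp F 2 P := memLp_of_bounded (a := a₁) (b := b₁) (ae_of_all _ h₁) hF.aestronglyMeasurable 2
  have mH : MemLp H 2 P := memLp_of_bounded (a := a₂) (b := b₂) (ae_of_all _ h₂) hH.aestronglyMeasurable 2
  have vF := variance_le_sq_of_bounded (ae_of_all P h₁) hF.aemeasurable
  have vH := variance_le_sq_of_bounded (ae_of_all P h₂) hH.aemeasurable
  have hc : ∫ x, F x * H x ∂P - (∫ x, F x ∂P) * ∫ x, H x ∂P = cov[F, H; P] := by
    rw [covariance_eq_sub mF mH]; rfl
  rw [hc]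
  have hd : ∀ τ : ℝ, 0 ≤ variance H P * (τ * τ) + (2 * cov[F, H; P]) * τ + variance F P := by
    intro τ
    have h0 := variance_nonneg (F + τ • H) P
    rw [variance_add mF (mH.const_smul τ), covariance_smul_right, variance_smul] at h0
    nlinarith
  have hdis := discrim_le_zero hd
  rw [discrim] at hdis
  obtain ⟨x⟩ : Nonempty Ω := by
    by_contra hne
    rw [not_nonempty_iff] at hne
    have := measure_univ (μ := P)
    rw [univ_eq_empty_iff.2 hne] at this
    simp at this
  have p1 : 0 ≤ b₁ - a₁ := by have := h₁ x; linarith [this.1, this.2]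
  have p2 : 0 ≤ b₂ - a₂ := by have := h₂ x; linarith [this.1, this.2]
  refine abs_le_of_sq_le_sq ?_ (by positivity)
  have := mul_le_mul vF vH (variance_nonneg _ _) (sq_nonneg _)
  nlinarith

open ProbabilityTheory in
lemma mgf_bound {Ω : Type*} [MeasurableSpace Ω] (P : Measure Ω) [IsProbabilityMeasure P]
    (F : Ω → ℝ) (hF : Measurable F) (a₁ b₁ l : ℝ)
    (h₁ : ∀ x, F x ∈ Icc a₁ b₁) :
    ∫ x, Real.exp (l * F x) ∂P ≤ Real.exp (l * ∫ x, F x ∂P + l ^ 2 * (b₁ - a₁) ^ 2 / 8) := by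
  have h := (hasSubgaussianMGF_of_mem_Icc hF.aemeasurable (ae_of_all P h₁)).mgf_le l
  rw [mgf] at h
  have e : ∀ x, Real.exp (l * (F x - ∫ x, F x ∂P)) = Real.exp (l * F x) * Real.exp (-(l * ∫ x, F x ∂P)) := by
    intro x; rw [← Real.exp_add]; congr 1; ring
  simp_rw [e] at h
  rw [integral_mul_const] at h
  rw [Real.exp_add]
  have h2 := mul_le_mul_of_nonneg_left h (Real.exp_pos (l * ∫ x, F x ∂P)).le
  rw [mul_comm, mul_assoc, ← Real.exp_add, neg_add_cancel, Real.exp_zero, mul_one] at h2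
  refine h2.trans (le_of_eq ?_)
  congr 2
  push_cast
  simp only [Real.norm_eq_abs, div_pow, sq_abs]
  ring

lemma cont_int {X : Type*} [TopologicalSpace X] [CompactSpace X] [MeasurableSpace X] [BorelSpace X]
    {m : Measure X} [IsFiniteMeasure m] {f : X → ℝ} (hf : Continuous f) : Integrable f m := by
  obtain ⟨C, hC⟩ := isCompact_univ.exists_bound_of_continuousOn hf.continuousOn
  exact Integrable.of_bound hf.measurable.aestronglyMeasurable C (ae_of_all _ fun x => hC x (mem_univ _))

/-- weighted measure -/
lemma weighted {X : Type*} [TopologicalSpace X] [CompactSpace X] [MeasurableSpace X] [BorelSpace X]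
    (m : Measure X) [IsProbabilityMeasure m] (w : X → ℝ) (hw : Continuous w) (hp : ∀ x, 0 < w x) :
    0 < ∫ x, w x ∂m ∧ ∃ P : Measure X, IsProbabilityMeasure P ∧
      ∀ f : X → ℝ, ∫ x, f x ∂P = (∫ x, f x * w x ∂m) / ∫ x, w x ∂m := by
  have hpos : 0 < ∫ x, w x ∂m := by
    rw [integral_pos_iff_support_of_nonneg (fun x => (hp x).le) (cont_int hw)]
    have : Function.support w = univ := by ext x; simp [(hp x).ne']
    rw [this]; simp
  refine ⟨hpos, m.withDensity (fun x => ENNReal.ofReal (w x / ∫ x, w x ∂m)), ?_, ?_⟩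
  · constructor
    rw [withDensity_apply _ MeasurableSet.univ, Measure.restrict_univ,
      ← ofReal_integral_eq_lintegral_ofReal, integral_div, div_self hpos.ne', ENNReal.ofReal_one]
    · exact cont_int (by fun_prop)
    · exact ae_of_all _ fun x => by have := hp x; positivity
  · intro f
    rw [integral_withDensity_eq_integral_toReal_smul]
    · rw [← integral_div]
      congr 1; ext x
      have := hp x
      rw [ENNReal.toReal_ofReal (by positivity), smul_eq_mul]; ring
    · have := hw.measurable; fun_prop
    · exact ae_of_all _ fun x => ENNReal.ofReal_lt_top

instance probT : IsProbabilityMeasure (volume : Measure 𝕋) := ⟨by simp⟩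

lemma fubini_cons {n : ℕ} (F : (Fin (n+1) → 𝕋) → ℝ) (hF : Continuous F) :
    ∫ x, F x = ∫ s : 𝕋, ∫ y : Fin n → 𝕋, F (Fin.cons s y) := by
  have h := (volume_preserving_piFinSuccAbove (fun _ : Fin (n+1) => 𝕋) 0).symm
  rw [← h.integral_comp' (g := F)]
  rw [Measure.volume_eq_prod, integral_prod]
  · simp [MeasurableEquiv.piFinSuccAbove]
    rfl
  · apply cont_int
    have : Continuous fun p : 𝕋 × (Fin n → 𝕋) => F (Fin.cons p.1 p.2) := by
      apply hF.comp
      fun_prop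
    simp only [MeasurableEquiv.piFinSuccAbove]
    simp
    exact this

/-- weighted average -/
noncomputable def Ev {n : ℕ} (ρ h : (Fin n → 𝕋) → ℝ) : ℝ := (∫ x, h x * ρ x) / ∫ x, ρ x

/-- slice -/
def sl {n : ℕ} (ρ : (Fin (n+1) → 𝕋) → ℝ) (s : 𝕋) : (Fin n → 𝕋) → ℝ := fun y => ρ (Fin.cons s y)

structure Good {n : ℕ} (η : ℝ) (ρ : (Fin n → 𝕋) → ℝ) : Prop where
  cont : Continuous ρ
  pos : ∀ x, 0 < ρ x
  cross : ∀ i k : Fin n, i ≠ k → ∀ (x : Fin n → 𝕋) (s t : 𝕋),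
    ρ x * ρ (Function.update (Function.update x k t) i s) ≤
      Real.exp η * (ρ (Function.update x i s) * ρ (Function.update x k t))

def Osc {n : ℕ} (δ : ℝ) (h : (Fin n → 𝕋) → ℝ) : Prop :=
  ∀ (j : Fin n) (x : Fin n → 𝕋) (t : 𝕋), |h x - h (Function.update x j t)| ≤ δ

lemma sl_cont {n : ℕ} {h : (Fin (n+1) → 𝕋) → ℝ} (hh : Continuous h) :
    Continuous fun p : 𝕋 × (Fin n → 𝕋) => sl h p.1 p.2 := by
  apply hh.comp
  fun_prop

lemma sl_cont' {n : ℕ} {h : (Fin (n+1) → 𝕋) → ℝ} (hh : Continuous h) (s : 𝕋) :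
    Continuous (sl h s) := by
  apply hh.comp
  fun_prop

lemma sl_osc {n : ℕ} {δ : ℝ} {h : (Fin (n+1) → 𝕋) → ℝ} (hh : Osc δ h) (s : 𝕋) :
    Osc δ (sl h s) := by
  intro j x t
  have := hh j.succ (Fin.cons s x) t
  rwa [← Fin.cons_update] at this

lemma sl_good {n : ℕ} {η : ℝ} {h : (Fin (n+1) → 𝕋) → ℝ} (hh : Good η h) (s : 𝕋) :
    Good η (sl h s) := by
  refine ⟨sl_cont' hh.cont s, fun x => hh.pos _, ?_⟩
  intro i k hik x u t
  have := hh.cross i.succ k.succ (by simpa using hik) (Fin.cons s x) u t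
  rwa [← Fin.cons_update, ← Fin.cons_update, ← Fin.cons_update] at this

lemma Ev_meas {n : ℕ} (ρ : (Fin n → 𝕋) → ℝ) (hc : Continuous ρ) (hp : ∀ x, 0 < ρ x) :
    ∃ P : Measure (Fin n → 𝕋), IsProbabilityMeasure P ∧ ∀ f, Ev ρ f = ∫ x, f x ∂P := by
  obtain ⟨-, P, hP, h⟩ := weighted volume ρ hc hp
  exact ⟨P, hP, fun f => (h f).symm⟩

lemma cont_param {n : ℕ} {h : (Fin (n+1) → 𝕋) → ℝ} (hh : Continuous h) :
    Continuous fun s => ∫ y, sl h s y := by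
  have := continuous_parametric_integral_of_continuous (μ := (volume : Measure (Fin n → 𝕋)))
    (f := fun s y => sl h s y) (sl_cont hh) isCompact_univ
  simpa using this

lemma Z_pos {n : ℕ} {ρ : (Fin n → 𝕋) → ℝ} (hc : Continuous ρ) (hp : ∀ x, 0 < ρ x) :
    0 < ∫ x, ρ x := (weighted volume ρ hc hp).1

lemma Ev_sl_cont {n : ℕ} {ρ h : (Fin (n+1) → 𝕋) → ℝ} (hc : Continuous ρ) (hp : ∀ x, 0 < ρ x)
    (hh : Continuous h) : Continuous fun s => Ev (sl ρ s) (sl h s) := by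
  unfold Ev
  refine Continuous.div ?_ (cont_param hc) (fun s => (Z_pos (sl_cont' hc s) fun x => hp _).ne')
  exact cont_param (h := fun x => h x * ρ x) (hh.mul hc)

lemma Ev_cons {n : ℕ} (ρ : (Fin (n+1) → 𝕋) → ℝ) (hc : Continuous ρ) (hp : ∀ x, 0 < ρ x) :
    ∃ P : Measure 𝕋, IsProbabilityMeasure P ∧
      ∀ f, Continuous f → Ev ρ f = ∫ s, Ev (sl ρ s) (sl f s) ∂P := by
  have hz : ∀ s, 0 < ∫ y, sl ρ s y := fun s => Z_pos (sl_cont' hc s) fun x => hp _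
  obtain ⟨-, P, hP, h⟩ := weighted volume (fun s => ∫ y, sl ρ s y) (cont_param hc) hz
  refine ⟨P, hP, fun f hf => ?_⟩
  rw [h, Ev, fubini_cons _ (hf.fun_mul hc), fubini_cons _ hc]
  congr 2
  ext s
  rw [Ev, div_mul_cancel₀ _ (hz s).ne']
  rfl

/-- chain of single-coordinate changes -/
lemma chain {n : ℕ} (q : (Fin n → 𝕋) → ℝ) (c : ℝ) (hc : 0 ≤ c)
    (h : ∀ j x t, q (Function.update x j t) ≤ c * q x) (x y : Fin n → 𝕋) :
    q y ≤ c ^ n * q x := by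
  have key : ∀ S : Finset (Fin n), q (fun j => if j ∈ S then y j else x j) ≤ c ^ S.card * q x := by
    intro S
    induction S using Finset.induction_on with
    | empty => simp
    | insert a S ha ih =>
      have e : (fun j => if j ∈ insert a S then y j else x j) =
          Function.update (fun j => if j ∈ S then y j else x j) a (y a) := by
        ext j
        by_cases hj : j = a
        · subst hj; simp
        · simp [hj]
      rw [e, Finset.card_insert_of_notMem ha, pow_succ']
      refine (h _ _ _).trans ?_
      rw [mul_assoc]
      exact mul_le_mul_of_nonneg_left ih hc
  simpa using key Finset.univ

def CovB (n : ℕ) (η : ℝ) : Prop :=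
  ∀ ρ : (Fin n → 𝕋) → ℝ, Good η ρ → ∀ f h : (Fin n → 𝕋) → ℝ, Continuous f → Continuous h →
    ∀ δ₁ δ₂ : ℝ, 0 ≤ δ₁ → 0 ≤ δ₂ → Osc δ₁ f → Osc δ₂ h →
    |Ev ρ (fun x => f x * h x) - Ev ρ f * Ev ρ h| ≤ n / 2 * δ₁ * δ₂

lemma num_bound : 1 + Real.exp (1/2) / 4 ≤ √2 := by
  have h1 : Real.exp (1/2) ≤ 1.65 := by
    have h := Real.exp_one_lt_d9
    have e : Real.exp 1 = Real.exp (1/2) * Real.exp (1/2) := by rw [← Real.exp_add]; norm_num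
    have := Real.exp_pos (1/2)
    nlinarith
  apply Real.le_sqrt_of_sq_le
  have := Real.exp_pos (1/2)
  nlinarith

lemma stepA {n : ℕ} {η : ℝ} (h0 : 0 ≤ η) (hn : n * η ≤ 1 / 2) (hB : CovB n η)
    (ρ : (Fin (n+1) → 𝕋) → ℝ) (hρ : Good η ρ) (h : (Fin (n+1) → 𝕋) → ℝ) (hh : Continuous h)
    (δ : ℝ) (hδ : 0 ≤ δ) (ho : Osc δ h) (s t : 𝕋) :
    |Ev (sl ρ s) (sl h s) - Ev (sl ρ t) (sl h t)| ≤ √2 * δ := by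
  have gs := sl_good hρ s
  have gt := sl_good hρ t
  have zs := Z_pos gs.cont gs.pos
  have zt := Z_pos gt.cont gt.pos
  have one : |Ev (sl ρ s) (sl h s) - Ev (sl ρ s) (sl h t)| ≤ δ := by
    obtain ⟨P, hP, hE⟩ := Ev_meas _ gs.cont gs.pos
    rw [hE, hE, ← integral_sub (cont_int (sl_cont' hh s)) (cont_int (sl_cont' hh t))]
    have := norm_integral_le_of_norm_le_const (μ := P) (f := fun x => sl h s x - sl h t x) (C := δ)
      (ae_of_all _ fun y => by
        have := ho 0 (Fin.cons s y) t
        rw [Fin.update_cons_zero] at this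
        exact this)
    simpa using this
  set q : (Fin n → 𝕋) → ℝ := fun y => sl ρ s y / sl ρ t y with hq
  have qc : Continuous q := gs.cont.div gt.cont fun x => (gt.pos x).ne'
  have qp : ∀ y, 0 < q y := fun y => div_pos (gs.pos y) (gt.pos y)
  have qstep : ∀ j x u, q (Function.update x j u) ≤ Real.exp η * q x := by
    intro j x u
    have := hρ.cross j.succ 0 (Fin.succ_ne_zero j) (Fin.cons t x) u s
    rw [Fin.update_cons_zero, ← Fin.cons_update, ← Fin.cons_update] at this
    have p1 := gt.pos x
    have p2 := gt.pos (Function.update x j u)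
    simp only [hq]
    rw [div_le_iff₀ p2, mul_comm (Real.exp η), div_mul_eq_mul_div, div_mul_eq_mul_div, le_div_iff₀ p1]
    simp only [sl]
    linarith
  set c := (∫ y, sl ρ s y) / ∫ y, sl ρ t y with hcdef
  have cpos : 0 < c := div_pos zs zt
  have qc_le : ∀ y, q y ≤ Real.exp (1/2) * c := by
    intro y
    have h1 : ∀ x, q y * sl ρ t x ≤ Real.exp (1/2) * sl ρ s x := by
      intro x
      have h2 := chain q (Real.exp η) (Real.exp_pos _).le qstep x y
      rw [← Real.exp_nat_mul] at h2
      have h3 : q y ≤ Real.exp (1/2) * q x :=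
        h2.trans (mul_le_mul_of_nonneg_right (Real.exp_le_exp.2 hn) (qp x).le)
      have h4 := mul_le_mul_of_nonneg_right h3 (gt.pos x).le
      rwa [mul_assoc, hq, div_mul_cancel₀ _ (gt.pos x).ne'] at h4
    have h5 := integral_mono (μ := volume) ((cont_int gt.cont).const_mul _) ((cont_int gs.cont).const_mul _) h1
    simp only [integral_const_mul] at h5
    rw [hcdef, ← mul_div_assoc, le_div_iff₀ zt]
    exact h5
  have qosc : Osc (Real.exp (1/2) * η * c) q := by
    have aux : ∀ j x u, q (Function.update x j u) - q x ≤ Real.exp (1/2) * η * c := by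
      intro j x u
      have h1 := qstep j x u
      have h2 : (1 - η) * q (Function.update x j u) ≤ q x := by
        have h3 : Real.exp (-η) * q (Function.update x j u) ≤ q x := by
          rw [Real.exp_neg, inv_mul_le_iff₀ (Real.exp_pos _)]; exact h1
        refine le_trans (mul_le_mul_of_nonneg_right ?_ (qp _).le) h3
        linarith [Real.add_one_le_exp (-η)]
      have h4 := mul_le_mul_of_nonneg_left (qc_le (Function.update x j u)) h0
      linarith
    intro j x u
    rw [abs_le]
    constructor
    · linarith [aux j x u]
    · have := aux j (Function.update x j u) (x j)
      simpa using this
  have cv := hB (sl ρ t) gt q (sl h t) qc (sl_cont' hh t) _ δ (by positivity) hδ qosc (sl_osc ho t)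
  have e1 : Ev (sl ρ t) q = c := by
    rw [Ev, hcdef]
    congr 2; ext y
    simp only [hq]
    rw [div_mul_cancel₀ _ (gt.pos y).ne']
  have e2 : Ev (sl ρ t) (fun x => q x * sl h t x) = c * Ev (sl ρ s) (sl h t) := by
    have : ∀ y, q y * sl h t y * sl ρ t y = sl h t y * sl ρ s y := by
      intro y
      simp only [hq]
      have := (gt.pos y).ne'
      field_simp
    simp only [Ev, this, hcdef]
    field_simp
  rw [e1, e2, ← mul_sub, abs_mul, abs_of_pos cpos] at cv
  have two : |Ev (sl ρ s) (sl h t) - Ev (sl ρ t) (sl h t)| ≤ Real.exp (1/2) / 4 * δ := by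
    refine le_of_mul_le_mul_left (cv.trans ?_) cpos
    have : (n:ℝ) / 2 * (Real.exp (1/2) * η * c) * δ = (n * η) * (c * Real.exp (1/2) * δ / 2) := by ring
    rw [this]
    have := mul_le_mul_of_nonneg_right hn (show 0 ≤ c * Real.exp (1/2) * δ / 2 by positivity)
    linarith
  calc _ ≤ |Ev (sl ρ s) (sl h s) - Ev (sl ρ s) (sl h t)| + |Ev (sl ρ s) (sl h t) - Ev (sl ρ t) (sl h t)| :=
        abs_sub_le _ _ _
    _ ≤ δ + Real.exp (1/2) / 4 * δ := add_le_add one two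
    _ = (1 + Real.exp (1/2) / 4) * δ := by ring
    _ ≤ _ := mul_le_mul_of_nonneg_right num_bound hδ

lemma interval_of_osc (H : 𝕋 → ℝ) (hH : Continuous H) (D : ℝ) (h : ∀ s t, |H s - H t| ≤ D) :
    ∃ a, ∀ s, H s ∈ Icc a (a + D) := by
  obtain ⟨s0, -, hs⟩ := isCompact_univ.exists_isMinOn univ_nonempty hH.continuousOn
  refine ⟨H s0, fun s => ⟨hs (mem_univ s), ?_⟩⟩
  linarith [(abs_le.1 (h s s0)).2]

lemma Ev_zero (ρ f : (Fin 0 → 𝕋) → ℝ) (hc : Continuous ρ) (hp : ∀ x, 0 < ρ x) : Ev ρ f = f default := by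
  obtain ⟨P, hP, hE⟩ := Ev_meas ρ hc hp
  rw [hE]
  have : ∀ x, f x = f default := fun x => by rw [Subsingleton.elim x default]
  simp [this]

lemma covB_all {η : ℝ} (h0 : 0 ≤ η) : ∀ n : ℕ, n * η ≤ 1 / 2 → CovB n η := by
  intro n
  induction n with
  | zero =>
    intro _ ρ hρ f h hf hh δ₁ δ₂ _ _ _ _
    simp [Ev_zero _ _ hρ.cont hρ.pos]
  | succ n ih =>
    intro hn ρ hρ f h hf hh δ₁ δ₂ hδ₁ hδ₂ o₁ o₂
    have hn' : n * η ≤ 1 / 2 := by push_cast at hn; linarith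
    have hB := ih hn'
    obtain ⟨P, hP, hE⟩ := Ev_cons ρ hρ.cont hρ.pos
    have cF := Ev_sl_cont hρ.cont hρ.pos hf
    have cH := Ev_sl_cont hρ.cont hρ.pos hh
    have cFH := Ev_sl_cont hρ.cont hρ.pos (hf.fun_mul hh)
    set F := fun s => Ev (sl ρ s) (sl f s) with hF
    set H := fun s => Ev (sl ρ s) (sl h s) with hH
    set G := fun s => Ev (sl ρ s) (sl (fun x => f x * h x) s) with hG
    obtain ⟨a₁, ha₁⟩ := interval_of_osc F cF _ (stepA h0 hn' hB ρ hρ f hf δ₁ hδ₁ o₁)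
    obtain ⟨a₂, ha₂⟩ := interval_of_osc H cH _ (stepA h0 hn' hB ρ hρ h hh δ₂ hδ₂ o₂)
    have c1 := cov_bound P F H cF.measurable cH.measurable _ _ _ _ ha₁ ha₂
    have c2 : |∫ s, (G s - F s * H s) ∂P| ≤ n / 2 * δ₁ * δ₂ := by
      have := norm_integral_le_of_norm_le_const (μ := P) (f := fun s => G s - F s * H s)
        (C := n / 2 * δ₁ * δ₂) (ae_of_all _ fun s =>
          hB (sl ρ s) (sl_good hρ s) (sl f s) (sl h s) (sl_cont' hf s) (sl_cont' hh s) δ₁ δ₂ hδ₁ hδ₂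
            (sl_osc o₁ s) (sl_osc o₂ s))
      simpa using this
    rw [integral_sub (cont_int cFH) (cont_int (cF.fun_mul cH))] at c2
    rw [hE _ (hf.fun_mul hh), hE f hf, hE h hh]
    have sq : √2 * √2 = 2 := Real.mul_self_sqrt (by norm_num)
    have c3 : (a₁ + √2 * δ₁ - a₁) * (a₂ + √2 * δ₂ - a₂) / 4 = δ₁ * δ₂ / 2 := by
      linear_combination δ₁ * δ₂ / 4 * sq
    rw [c3] at c1
    push_cast
    calc _ = |(∫ s, G s ∂P - ∫ s, F s * H s ∂P) + (∫ s, F s * H s ∂P - (∫ s, F s ∂P) * ∫ s, H s ∂P)| := by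
          congr 1; ring
      _ ≤ _ := abs_add_le _ _
      _ ≤ n / 2 * δ₁ * δ₂ + δ₁ * δ₂ / 2 := add_le_add c2 c1
      _ = _ := by ring

lemma mgf_all {η : ℝ} (h0 : 0 ≤ η) : ∀ n : ℕ, n * η ≤ 1 / 2 →
    ∀ ρ : (Fin n → 𝕋) → ℝ, Good η ρ → ∀ h : (Fin n → 𝕋) → ℝ, Continuous h →
    ∀ δ : ℝ, 0 ≤ δ → Osc δ h → ∀ l : ℝ,
    Ev ρ (fun x => Real.exp (l * h x)) ≤ Real.exp (l * Ev ρ h + n * l ^ 2 * δ ^ 2 / 4) := by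
  intro n
  induction n with
  | zero =>
    intro _ ρ hρ h hh δ _ _ l
    simp [Ev_zero _ _ hρ.cont hρ.pos]
  | succ n ih =>
    intro hn ρ hρ h hh δ hδ ho l
    have hn' : n * η ≤ 1 / 2 := by push_cast at hn; linarith
    have hB := covB_all h0 n hn'
    obtain ⟨P, hP, hE⟩ := Ev_cons ρ hρ.cont hρ.pos
    have cH := Ev_sl_cont hρ.cont hρ.pos hh
    have he : Continuous fun x => Real.exp (l * h x) := by fun_prop
    have cE := Ev_sl_cont hρ.cont hρ.pos he
    rw [hE _ he, hE h hh]
    obtain ⟨a, ha⟩ := interval_of_osc _ cH _ (stepA h0 hn' hB ρ hρ h hh δ hδ ho)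
    set H := fun s => Ev (sl ρ s) (sl h s) with hH
    have m := mgf_bound P H cH.measurable _ _ l ha
    have sq : √2 ^ 2 = 2 := Real.sq_sqrt (by norm_num)
    calc _ ≤ ∫ s, Real.exp (l * H s) * Real.exp (n * l ^ 2 * δ ^ 2 / 4) ∂P := by
          apply integral_mono (cont_int cE) (cont_int (by fun_prop))
          intro s
          have := ih hn' (sl ρ s) (sl_good hρ s) (sl h s) (sl_cont' hh s) δ hδ (sl_osc ho s) l
          rw [Real.exp_add] at this
          exact this
      _ = (∫ s, Real.exp (l * H s) ∂P) * Real.exp (n * l ^ 2 * δ ^ 2 / 4) := integral_mul_const _ _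
      _ ≤ _ := mul_le_mul_of_nonneg_right m (Real.exp_pos _).le
      _ = _ := by
        rw [← Real.exp_add]
        congr 1
        push_cast
        linear_combination l ^ 2 * δ ^ 2 / 8 * sq

lemma beta_prop {a b : ℝ} (ha : 0 < a) (hab : a ≤ b) {ψ₁ ψ₂ : 𝕋 → ℝ} (h₁ : ψ₁ ∈ Vcone a)
    (h₂ : ψ₂ ∈ Vcone a) : 0 < betaH b ψ₁ ψ₂ ∧ ∀ x, ψ₂ x ≤ betaH b ψ₁ ψ₂ * ψ₁ x := by
  obtain ⟨c1, p1, d1⟩ := h₁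
  obtain ⟨c2, p2, d2⟩ := h₂
  have hb : 0 < b := ha.trans_le hab
  have per : ∀ ψ : 𝕋 → ℝ, Function.Periodic (lift1 ψ) 1 := by
    intro ψ x
    simp [lift1]
  have perd : ∀ ψ : 𝕋 → ℝ, Function.Periodic (deriv (lift1 ψ)) 1 := by
    intro ψ x
    rw [← deriv_comp_add_const]
    congr 1
    ext y
    exact per ψ y
  have cd1 : Continuous (deriv (lift1 ψ₁)) := c1.continuous_deriv (by norm_num)
  have cd2 : Continuous (deriv (lift1 ψ₂)) := c2.continuous_deriv (by norm_num)
  have cc1 := c1.continuous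
  have cc2 := c2.continuous
  have den : ∀ x, 0 < b * lift1 ψ₁ x - |deriv (lift1 ψ₁) x| := by
    intro x
    have := mul_le_mul_of_nonneg_right hab (p1 (x : 𝕋)).le
    have h := d1 x
    simp only [lift1] at h ⊢
    linarith
  let r : ℝ → ℝ := fun x => (|deriv (lift1 ψ₂) x| + b * lift1 ψ₂ x) /
    (b * lift1 ψ₁ x - |deriv (lift1 ψ₁) x|)
  have rc : Continuous r := by
    refine Continuous.div (by fun_prop) (by fun_prop) (fun x => (den x).ne')
  have rp : Function.Periodic r 1 := by
    intro x
    simp only [r, per ψ₁ x, per ψ₂ x, perd ψ₁ x, perd ψ₂ x]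
  obtain ⟨T, hT⟩ := (rp.compact_of_continuous one_ne_zero rc).bddAbove
  have hmem : |T| + 1 ∈ {t : ℝ | 0 < t ∧ (fun x => t * ψ₁ x - ψ₂ x) ∈ Vcone b} := by
    have tp : 0 < |T| + 1 := by positivity
    set t := |T| + 1 with ht
    have el : lift1 (fun x => t * ψ₁ x - ψ₂ x) = fun x => t * lift1 ψ₁ x - lift1 ψ₂ x := rfl
    have key : ∀ x, |deriv (lift1 (fun x => t * ψ₁ x - ψ₂ x)) x| <
        b * lift1 (fun x => t * ψ₁ x - ψ₂ x) x := by
      intro x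
      have e : deriv (lift1 (fun x => t * ψ₁ x - ψ₂ x)) x =
          t * deriv (lift1 ψ₁) x - deriv (lift1 ψ₂) x := by
        rw [el]
        have D1 := (c1.differentiable (by norm_num) x).hasDerivAt
        have D2 := (c2.differentiable (by norm_num) x).hasDerivAt
        exact ((D1.const_mul t).sub D2).deriv
      rw [e, el]
      have h1 : r x < t := (hT (mem_range_self x)).trans_lt (by linarith [le_abs_self T])
      rw [div_lt_iff₀ (den x)] at h1
      have h2 := abs_sub (t * deriv (lift1 ψ₁) x) (deriv (lift1 ψ₂) x)
      rw [abs_mul, abs_of_pos tp] at h2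
      simp only
      nlinarith
    refine ⟨tp, ?_, ?_, key⟩
    · rw [el]
      exact (contDiff_const.mul c1).sub c2
    · intro x
      obtain ⟨y, rfl⟩ := QuotientAddGroup.mk_surjective x
      have := (abs_nonneg _).trans_lt (key y)
      exact pos_of_mul_pos_right this hb.le
  have main : ∀ x, ψ₂ x / ψ₁ x ≤ betaH b ψ₁ ψ₂ := by
    intro x
    refine le_csInf ⟨_, hmem⟩ ?_
    rintro t ⟨-, -, ht, -⟩
    rw [div_le_iff₀ (p1 x)]
    linarith [ht x]
  refine ⟨(div_pos (p2 0) (p1 0)).trans_le (main 0), fun x => ?_⟩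
  have := main x
  rwa [div_le_iff₀ (p1 x)] at this

lemma dens_cont {N : ℕ} {ρ : (Fin N → 𝕋) → ℝ} (h : IsC2Density ρ) : Continuous ρ := by
  have hq : IsOpenQuotientMap (Pi.map fun (_ : Fin N) (x : ℝ) => (x : 𝕋)) :=
    IsOpenQuotientMap.piMap fun _ => QuotientAddGroup.isOpenQuotientMap_mk
  rw [hq.isQuotientMap.continuous_iff]
  exact h.1.continuous

lemma good_of_memM {a b : ℝ} (ha : 0 < a) (hab : a ≤ b) {N : ℕ}
    {ρ : (Fin N → 𝕋) → ℝ} (h : IsC2Density ρ) (hM : MemM a b (1 / (N : ℝ)) ρ) :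
    Good (1 / (2 * (N : ℝ))) ρ := by
  have hc := dens_cont h
  refine ⟨hc, h.2, ?_⟩
  intro i k hik x s t
  obtain ⟨hV, hθ⟩ := hM i k hik.symm
  have hθ := hθ x t
  have hd : dist (x k) t ≤ 1 / 2 := by
    rw [dist_eq_norm]
    have := AddCircle.norm_le_half_period (p := (1:ℝ)) (x := x k - t) one_ne_zero
    simpa using this
  have hθ2 : thetaH b (condDens ρ i x) (condDens ρ i (Function.update x k t)) ≤ 1 / (2 * (N:ℝ)) := by
    refine hθ.trans ?_
    have : 1 / (2 * (N:ℝ)) = 1 / (N:ℝ) * (1 / 2) := by rw [mul_comm 2, one_div_mul_one_div]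
    rw [this]
    exact mul_le_mul_of_nonneg_left hd (by positivity)
  obtain ⟨b1, m1⟩ := beta_prop ha hab (hV x) (hV (Function.update x k t))
  obtain ⟨b2, m2⟩ := beta_prop ha hab (hV (Function.update x k t)) (hV x)
  rw [thetaH, ← Real.log_mul b1.ne' b2.ne', Real.log_le_iff_le_exp (mul_pos b1 b2)] at hθ2
  set B1 := betaH b (condDens ρ i x) (condDens ρ i (Function.update x k t))
  set B2 := betaH b (condDens ρ i (Function.update x k t)) (condDens ρ i x)
  have m1 := m1 s
  have m2 := m2 (x i)
  have e1 : Function.update x i (x i) = x := Function.update_eq_self i x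
  have e2 : Function.update (Function.update x k t) i (x i) = Function.update x k t := by
    rw [Function.update_eq_self_iff, Function.update_of_ne hik]
  simp only [condDens, e1, e2] at m1 m2
  have up : ∀ (y : Fin N → 𝕋), 0 < ∫ s : 𝕋, ρ (Function.update y i s) := by
    intro y
    refine (weighted volume (fun s : 𝕋 => ρ (Function.update y i s)) ?_ fun _ => h.2 _).1
    exact hc.comp (continuous_const.update i continuous_id)
  have Z1 := up x
  have Z2 := up (Function.update x k t)
  set z1 := ∫ s : 𝕋, ρ (Function.update x i s)
  set z2 := ∫ s : 𝕋, ρ (Function.update (Function.update x k t) i s)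
  have r1 := h.2 x
  have r2 := h.2 (Function.update (Function.update x k t) i s)
  have r3 := h.2 (Function.update x i s)
  have r4 := h.2 (Function.update x k t)
  set q1 := ρ x
  set q2 := ρ (Function.update (Function.update x k t) i s)
  set q3 := ρ (Function.update x i s)
  set q4 := ρ (Function.update x k t)
  have hm := mul_le_mul m2 m1 (by positivity) (by positivity)
  have e3 : q1 / z1 * (q2 / z2) = (q1 * q2) / (z1 * z2) := by field_simp
  have e4 : B2 * (q4 / z2) * (B1 * (q3 / z1)) = (B1 * B2 * (q3 * q4)) / (z1 * z2) := by field_simp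
  rw [e3, e4, div_le_div_iff_of_pos_right (by positivity)] at hm
  exact hm.trans (mul_le_mul_of_nonneg_right hθ2 (by positivity))

open scoped Convolution in
lemma smooth {N : ℕ} (g : (Fin N → 𝕋) → ℝ) (hg : Integrable g volume) (δ : ℝ) (ho : Osc δ g)
    (τ : ℝ) (hτ : 0 < τ) :
    ∃ φ : (Fin N → 𝕋) → ℝ, Continuous φ ∧ Osc δ φ ∧ ∫ x, |g x - φ x| ≤ τ := by
  have n1 : (volume : Measure 𝕋).IsNegInvariant := inferInstance
  have n2 : (volume : Measure (Fin N → 𝕋)).IsNegInvariant := inferInstance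
  obtain ⟨φ0, -, hφ, cφ, -⟩ := hg.exists_hasCompactSupport_integral_sub_le (half_pos hτ |> half_pos)
  have iφ : Integrable φ0 (volume : Measure (Fin N → 𝕋)) := cont_int cφ
  have uc := CompactSpace.uniformContinuous_of_continuous cφ
  rw [Metric.uniformContinuous_iff] at uc
  obtain ⟨r, hr, huc⟩ := uc (τ / 2) (half_pos hτ)
  set k : (Fin N → 𝕋) → ℝ := fun z => max 0 (r - ‖z‖) with hk
  have kc : Continuous k := by fun_prop
  have k0 : ∀ z, 0 ≤ k z := fun z => le_max_left _ _
  have ik : Integrable k (volume : Measure (Fin N → 𝕋)) := cont_int kc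
  set c := ∫ z, k z with hc
  have cpos : 0 < c := by
    refine kc.integral_pos_of_hasCompactSupport_nonneg_nonzero (HasCompactSupport.of_compactSpace k) k0 (x := 0) ?_
    simp [hk]
    exact hr
  let L := ContinuousLinearMap.mul ℝ ℝ
  have kb : BddAbove (range fun x => ‖k x‖) := by
    obtain ⟨C, hC⟩ := isCompact_univ.exists_bound_of_continuousOn kc.continuousOn
    exact ⟨C, by rintro _ ⟨x, rfl⟩; exact hC x (mem_univ _)⟩
  have ev : ∀ (f : (Fin N → 𝕋) → ℝ) x, (f ⋆[L, volume] k) x = ∫ z, f (x - z) * k z := by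
    intro f x
    rw [convolution_eq_swap]; rfl
  have ish : ∀ (f : (Fin N → 𝕋) → ℝ), Integrable f volume → ∀ x, Integrable (fun z => f (x - z) * k z) volume := by
    intro f hf x
    obtain ⟨C, hC⟩ := kb
    refine (hf.comp_sub_left x).mul_bdd (c := C) kc.aestronglyMeasurable (ae_of_all _ fun z => hC (mem_range_self z))
  refine ⟨fun x => (g ⋆[L, volume] k) x / c, ?_, ?_, ?_⟩
  · exact (kb.continuous_convolution_right_of_integrable L hg kc).div_const c
  · intro j x t
    simp only [ev]
    rw [← sub_div, ← integral_sub (ish g hg _) (ish g hg _), abs_div, abs_of_pos cpos, div_le_iff₀ cpos,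
      hc, ← integral_const_mul]
    refine abs_integral_le_integral_abs.trans ?_
    refine integral_mono ((ish g hg _).sub (ish g hg _)).abs (ik.const_mul δ) ?_
    intro z
    simp only
    rw [← sub_mul, abs_mul, abs_of_nonneg (k0 z)]
    refine mul_le_mul_of_nonneg_right ?_ (k0 z)
    have := ho j (x - z) (t - z j)
    have e : Function.update x j t - z = Function.update (x - z) j (t - z j) := by
      ext i
      by_cases hi : i = j
      · subst hi; simp
      · simp [hi]
    rw [e]; exact this
  · set h : (Fin N → 𝕋) → ℝ := fun x => |g x - φ0 x| with hh
    have ih : Integrable h volume := (hg.sub iφ).abs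
    have hφ' : ∫ x, h x ≤ τ / 2 / 2 := hφ
    have ihk : Integrable (h ⋆[L, volume] k) volume := ih.integrable_convolution L ik
    have igk : Integrable (g ⋆[L, volume] k) volume := hg.integrable_convolution L ik
    have hint : ∫ x, (h ⋆[L, volume] k) x = (∫ x, h x) * c := integral_convolution L ih ik
    have pt : ∀ x, |g x - (g ⋆[L, volume] k) x / c| ≤ h x + τ / 2 + (h ⋆[L, volume] k) x / c := by
      intro x
      have mid : |φ0 x - (φ0 ⋆[L, volume] k) x / c| ≤ τ / 2 := by
        have : φ0 x - (φ0 ⋆[L, volume] k) x / c = (∫ z, (φ0 x - φ0 (x - z)) * k z) / c := by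
          simp only [sub_mul]
          rw [integral_sub (ik.const_mul _) (ish φ0 iφ x), integral_const_mul, ev, sub_div,
            mul_div_cancel_right₀ _ cpos.ne']
        rw [this, abs_div, abs_of_pos cpos, div_le_iff₀ cpos, hc, ← integral_const_mul]
        refine abs_integral_le_integral_abs.trans ?_
        have cc : Continuous fun z => (φ0 x - φ0 (x - z)) * k z := by fun_prop
        refine integral_mono (cont_int cc.abs) (ik.const_mul _) ?_
        intro z
        simp only
        rw [abs_mul, abs_of_nonneg (k0 z)]
        by_cases hz : ‖z‖ < r
        · refine mul_le_mul_of_nonneg_right ?_ (k0 z)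
          have := huc (a := x) (b := x - z) (by simpa [dist_eq_norm] using hz)
          rw [Real.dist_eq] at this
          exact this.le
        · have : k z = 0 := by simp only [hk]; exact max_eq_left (by linarith)
          simp [this]
      have last : |(φ0 ⋆[L, volume] k) x / c - (g ⋆[L, volume] k) x / c| ≤ (h ⋆[L, volume] k) x / c := by
        rw [← sub_div, abs_div, abs_of_pos cpos, div_le_div_iff_of_pos_right cpos, ev, ev, ev,
          ← integral_sub (ish φ0 iφ _) (ish g hg _)]
        refine abs_integral_le_integral_abs.trans (le_of_eq ?_)
        congr 1; ext z
        rw [← sub_mul, abs_mul, abs_of_nonneg (k0 z), abs_sub_comm]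
      have t1 := abs_sub_le (g x) (φ0 x) ((g ⋆[L, volume] k) x / c)
      have t2 := abs_sub_le (φ0 x) ((φ0 ⋆[L, volume] k) x / c) ((g ⋆[L, volume] k) x / c)
      have : h x = |g x - φ0 x| := rfl
      linarith
    calc _ ≤ ∫ x, (h x + τ / 2 + (h ⋆[L, volume] k) x / c) :=
          integral_mono (hg.sub (igk.div_const c)).abs
            ((ih.add (integrable_const _)).add (ihk.div_const c)) pt
      _ = (∫ x, h x) + τ / 2 + (∫ x, h x) := by
          rw [integral_add (ih.fun_add (integrable_const _)) (ihk.div_const c),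
            integral_add ih (integrable_const _), integral_div c, hint, mul_div_cancel_right₀ _ cpos.ne']
          simp
      _ ≤ τ := by linarith

lemma osc_global {N : ℕ} (hN : 0 < N) {g : (Fin N → 𝕋) → ℝ} (ho : Osc (1 / (N : ℝ)) g) (x y) :
    g y - g x ≤ 1 := by
  have := chain (fun x => Real.exp (g x)) (Real.exp (1 / (N:ℝ))) (Real.exp_pos _).le
    (fun j x t => by
      rw [← Real.exp_add]
      apply Real.exp_le_exp.2
      linarith [(abs_le.1 (ho j x t)).1]) x y
  rw [← Real.exp_nat_mul, ← Real.exp_add, Real.exp_le_exp] at this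
  have hn : (N:ℝ) * (1 / N) = 1 := by
    have : (N:ℝ) ≠ 0 := by exact_mod_cast hN.ne'
    field_simp
  linarith

open ProbabilityTheory in
lemma subG {N : ℕ} (hN : 0 < N) (μ : Measure (Fin N → 𝕋)) [IsProbabilityMeasure μ]
    (ρ : (Fin N → 𝕋) → ℝ) (hd : HasDensity μ ρ) (hρ : Good (1 / (2 * (N : ℝ))) ρ)
    (g : (Fin N → 𝕋) → ℝ) (hg : Integrable g volume) (ho : Osc (1 / (N : ℝ)) g) :
    HasSubgaussianMGF (fun x => g x - ∫ y, g y ∂μ) (1 / (2 * (N : NNReal))) μ := by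
  have hN' : (0:ℝ) < N := by exact_mod_cast hN
  have intμ : ∀ f : (Fin N → 𝕋) → ℝ, ∫ x, f x ∂μ = ∫ x, f x * ρ x := by
    intro f
    rw [hd, integral_withDensity_eq_integral_toReal_smul]
    · congr 1; ext x
      rw [ENNReal.toReal_ofReal (hρ.pos x).le, smul_eq_mul, mul_comm]
    · exact hρ.cont.measurable.ennreal_ofReal
    · exact ae_of_all _ fun x => ENNReal.ofReal_lt_top
  have ρ1 : ∫ x, ρ x = 1 := by
    have := intμ (fun _ => 1)
    simpa using this.symm
  have evμ : ∀ f, Ev ρ f = ∫ x, f x ∂μ := by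
    intro f
    rw [Ev, ρ1, div_one, intμ]
  have ac : μ ≪ volume := by rw [hd]; exact withDensity_absolutelyContinuous _ _
  have am : AEStronglyMeasurable g μ := hg.aestronglyMeasurable.mono_ac ac
  have gI : Integrable g μ := by
    refine Integrable.of_bound am (|g 0| + 1) (ae_of_all _ fun x => ?_)
    have h1 := osc_global hN ho x 0
    have h2 := osc_global hN ho 0 x
    rw [Real.norm_eq_abs, abs_le]
    constructor
    · linarith [neg_abs_le (g 0)]
    · linarith [le_abs_self (g 0)]
  have Xb : ∀ x, |g x - ∫ y, g y ∂μ| ≤ 1 := by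
    intro x
    have h1 : ∫ y, g y ∂μ ≤ g x + 1 := by
      have := integral_mono (μ := μ) gI (integrable_const (g x + 1)) (fun y => by
        have := osc_global hN ho x y
        simp only; linarith)
      simpa using this
    have h2 : g x - 1 ≤ ∫ y, g y ∂μ := by
      have := integral_mono (μ := μ) (integrable_const (g x - 1)) gI (fun y => by
        have := osc_global hN ho y x
        simp only; linarith)
      simpa using this
    rw [abs_le]; constructor <;> linarith
  have lX : ∀ l x, l * (g x - ∫ y, g y ∂μ) ≤ |l| := by
    intro l x
    refine (le_abs_self _).trans ?_
    rw [abs_mul]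
    exact mul_le_of_le_one_right (abs_nonneg _) (Xb x)
  have eI : ∀ l : ℝ, Integrable (fun x => Real.exp (l * (g x - ∫ y, g y ∂μ))) μ := by
    intro l
    refine Integrable.of_bound ?_ (Real.exp |l|) (ae_of_all _ fun x => ?_)
    · exact Real.continuous_exp.comp_aestronglyMeasurable
        ((am.sub aestronglyMeasurable_const).const_mul l)
    · rw [Real.norm_eq_abs, abs_of_pos (Real.exp_pos _)]
      exact Real.exp_le_exp.2 (lX l x)
  refine ⟨eI, fun l => ?_⟩
  obtain ⟨M, hM⟩ := isCompact_univ.exists_bound_of_continuousOn hρ.cont.continuousOn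
  have hM : ∀ x, ρ x ≤ M := fun x => (le_abs_self _).trans (hM x (mem_univ _))
  have M0 : 0 < M := (hρ.pos 0).trans_le (hM 0)
  rw [mgf]
  refine le_of_forall_pos_le_add fun e he => ?_
  set K := Real.exp |l| * |l| * 2 * M with hK
  have K0 : 0 ≤ K := by positivity
  obtain ⟨φ, cφ, oφ, dφ⟩ := smooth g hg _ ho (e / (K + 1)) (by positivity)
  have Iφ : Integrable φ μ := cont_int cφ
  have d1 : ∫ x, |g x - φ x| ∂μ ≤ M * (e / (K + 1)) := by
    rw [intμ]
    refine le_trans ?_ (mul_le_mul_of_nonneg_left dφ M0.le)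
    rw [← integral_const_mul]
    have i1 : Integrable (fun x => |g x - φ x|) volume := (hg.sub (cont_int cφ)).abs
    refine integral_mono (i1.mul_bdd (c := M) hρ.cont.aestronglyMeasurable
      (ae_of_all _ fun x => ?_)) (i1.const_mul M) ?_
    · rw [Real.norm_eq_abs, abs_of_pos (hρ.pos x)]; exact hM x
    · intro x
      simp only
      rw [mul_comm]
      exact mul_le_mul_of_nonneg_right (hM x) (abs_nonneg _)
  have d2 : |∫ x, g x ∂μ - ∫ x, φ x ∂μ| ≤ M * (e / (K + 1)) := by
    rw [← integral_sub gI Iφ]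
    exact abs_integral_le_integral_abs.trans d1
  have mg := mgf_all (η := 1 / (2 * (N:ℝ))) (by positivity) N
    (by apply le_of_eq; field_simp) ρ hρ φ cφ (1 / (N:ℝ)) (by positivity) oφ l
  rw [evμ, evμ] at mg
  have mg2 : ∫ x, Real.exp (l * (φ x - ∫ y, φ y ∂μ)) ∂μ ≤ Real.exp (l ^ 2 / (4 * N)) := by
    have : ∀ x, Real.exp (l * (φ x - ∫ y, φ y ∂μ)) =
        Real.exp (l * φ x) * Real.exp (-(l * ∫ y, φ y ∂μ)) := by
      intro x; rw [← Real.exp_add]; congr 1; ring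
    simp only [this]
    rw [integral_mul_const]
    refine (mul_le_mul_of_nonneg_right mg (Real.exp_pos _).le).trans (le_of_eq ?_)
    rw [← Real.exp_add]
    congr 1
    field_simp
    ring
  have pt : ∀ x, Real.exp (l * (g x - ∫ y, g y ∂μ)) ≤ Real.exp (l * (φ x - ∫ y, φ y ∂μ)) +
      Real.exp |l| * |l| * (|g x - φ x| + |∫ x, g x ∂μ - ∫ x, φ x ∂μ|) := by
    intro x
    set u := l * (g x - ∫ y, g y ∂μ) with hu
    set v := l * (φ x - ∫ y, φ y ∂μ) with hv
    have h1 : Real.exp u - Real.exp v ≤ Real.exp u * (u - v) := by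
      have h2 : Real.exp v = Real.exp u * Real.exp (v - u) := by rw [← Real.exp_add]; congr 1; ring
      have h3 := mul_le_mul_of_nonneg_left (Real.add_one_le_exp (v - u)) (Real.exp_pos u).le
      rw [h2]; linarith
    have h4 : u - v ≤ |l| * (|g x - φ x| + |∫ x, g x ∂μ - ∫ x, φ x ∂μ|) := by
      have e : u - v = l * ((g x - φ x) - (∫ x, g x ∂μ - ∫ x, φ x ∂μ)) := by rw [hu, hv]; ring
      rw [e]
      refine (le_abs_self _).trans ?_
      rw [abs_mul]
      exact mul_le_mul_of_nonneg_left (abs_sub _ _) (abs_nonneg _)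
    have h5 : Real.exp u ≤ Real.exp |l| := Real.exp_le_exp.2 (lX l x)
    have h6 := mul_le_mul_of_nonneg_left h4 (Real.exp_pos u).le
    have h7 := mul_le_mul_of_nonneg_right h5
      (show 0 ≤ |l| * (|g x - φ x| + |∫ x, g x ∂μ - ∫ x, φ x ∂μ|) by positivity)
    linarith
  have iφe : Integrable (fun x => Real.exp (l * (φ x - ∫ y, φ y ∂μ))) μ := cont_int (by fun_prop)
  have igf : Integrable (fun x => |g x - φ x|) μ := (gI.sub Iφ).abs
  have irest : Integrable (fun x => Real.exp |l| * |l| * (|g x - φ x| + |∫ x, g x ∂μ - ∫ x, φ x ∂μ|)) μ :=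
    (igf.add (integrable_const _)).const_mul _
  have fin := integral_mono (eI l) (iφe.add irest) pt
  have e1 := integral_add iφe irest
  simp only [Pi.add_apply] at fin e1
  rw [e1, integral_const_mul, integral_add igf (integrable_const _)] at fin
  simp only [integral_const, probReal_univ, one_smul] at fin
  have last : Real.exp |l| * |l| * (∫ x, |g x - φ x| ∂μ + |∫ x, g x ∂μ - ∫ x, φ x ∂μ|) ≤ e := by
    have h1 : Real.exp |l| * |l| * (∫ x, |g x - φ x| ∂μ + |∫ x, g x ∂μ - ∫ x, φ x ∂μ|) ≤
        Real.exp |l| * |l| * (M * (e / (K + 1)) + M * (e / (K + 1))) :=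
      mul_le_mul_of_nonneg_left (add_le_add d1 d2) (by positivity)
    refine h1.trans ?_
    have h2 : Real.exp |l| * |l| * (M * (e / (K + 1)) + M * (e / (K + 1))) = K * e / (K + 1) := by
      rw [hK]; ring
    rw [h2, div_le_iff₀ (by positivity)]
    linarith
  have ec : Real.exp (l ^ 2 / (4 * N)) = Real.exp (((1 / (2 * (N : NNReal)) : NNReal) : ℝ) * l ^ 2 / 2) := by
    congr 1
    push_cast
    field_simp
    ring
  rw [← ec]
  linarith

/-- Concentration for quasi-product measures. -/
theorem concentration_quasiproduct :
    ∀ a b : ℝ, 0 < a → a ≤ b →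
    ∃ A : ℝ, 0 < A ∧ ∃ N₀ : ℕ, ∀ N : ℕ, N₀ ≤ N →
      ∀ (μ : Measure (Fin N → 𝕋)) (ρ : (Fin N → 𝕋) → ℝ),
        IsProbabilityMeasure μ → HasDensity μ ρ → IsC2Density ρ →
        MemM a b (1 / (N : ℝ)) ρ →
        ∀ g : (Fin N → 𝕋) → ℝ, OscBdd (1 / (N : ℝ)) g →
          ∀ ε : ℝ, 0 < ε →
            (μ {x | ε ≤ |g x - ∫ y, g y ∂μ|}).toReal
              ≤ 2 * Real.exp (-(ε ^ 2 * (N : ℝ)) / (1 + A / (N : ℝ)) ^ 2) := by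
  intro a b ha hab
  refine ⟨1, one_pos, 1, fun N hN μ ρ hμ hd hC hM g hg ε hε => ?_⟩
  have hN0 : 0 < N := hN
  have hN' : (0:ℝ) < N := by exact_mod_cast hN0
  have hs := subG hN0 μ ρ hd (good_of_memM ha hab hC hM) g hg.1 hg.2
  have h1 := hs.measure_ge_le hε.le
  have h2 := hs.neg.measure_ge_le hε.le
  have hsub : {x | ε ≤ |g x - ∫ y, g y ∂μ|} ⊆
      {x | ε ≤ g x - ∫ y, g y ∂μ} ∪ {x | ε ≤ (-fun x => g x - ∫ y, g y ∂μ) x} := by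
    intro x hx
    have hx' : ε ≤ |g x - ∫ y, g y ∂μ| := hx
    exact le_abs.1 hx'
  have h3 : μ.real {x | ε ≤ |g x - ∫ y, g y ∂μ|} ≤ 2 * Real.exp (-ε ^ 2 / (2 * ((1 / (2 * (N : NNReal)) : NNReal) : ℝ))) := by
    refine (measureReal_mono hsub).trans ((measureReal_union_le _ _).trans ?_)
    linarith
  refine h3.trans ?_
  refine mul_le_mul_of_nonneg_left (Real.exp_le_exp.2 ?_) (by norm_num)
  have e : -ε ^ 2 / (2 * ((1 / (2 * (N : NNReal)) : NNReal) : ℝ)) = -(ε ^ 2 * N) := by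
    push_cast
    field_simp
  rw [e, neg_div, neg_le_neg_iff]
  refine div_le_self (by positivity) ?_
  have : 0 ≤ 1 / (N:ℝ) := by positivity
  nlinarith
end

section
/- Let H: 𝕋^N → 𝕋^N satisfy Assumption (H1) with datum (κ,E) and Assumption (H2) with datum (K,E). For N sufficiently large and any i ∈ {1,…,N}, let Φ_i be the straightening diffeomorphism and define G_i: 𝕋 × 𝕋^{N−1} → 𝕋 by G_i(y_i; ŷ_i) := H_i(Φ_i(y_i, ŷ_i)). Then there is a constant C > 0 depending only on (κ,K,E), not on N, such that d_{C²}(G_i(·; x̂_i), H_i(·; x̂_i)) ≤ C·N⁻¹ for all x̂_i ∈ 𝕋^{N−1}. -/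
open MeasureTheory Filter Topology Set

namespace GiAux

theorem cd_pd {N : ℕ} {n m : WithTop ℕ∞} (g : (Fin N → ℝ) → ℝ) (hg : ContDiff ℝ n g)
    (hmn : m + 1 ≤ n) (k : Fin N) : ContDiff ℝ m (pd k g) := by
  unfold pd
  exact (hg.fderiv_right hmn).clm_apply contDiff_const

theorem pd_symm {N : ℕ} (g : (Fin N → ℝ) → ℝ) (hg : ContDiff ℝ 3 g) (j k : Fin N)
    (x : Fin N → ℝ) : pd k (pd j g) x = pd j (pd k g) x := by
  have hd : DifferentiableAt ℝ (fderiv ℝ g) x :=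
    ((hg.fderiv_right (m := 2) (by norm_num)).differentiable (by norm_num)) x
  have key : ∀ a b : Fin N, pd a (pd b g) x
      = fderiv ℝ (fderiv ℝ g) x (Pi.single a 1) (Pi.single b 1) := by
    intro a b
    unfold pd
    rw [fderiv_clm_apply hd (by fun_prop)]
    simp
  rw [key, key]
  have := (hg.contDiffAt (x := x)).isSymmSndFDerivAt (by simp; norm_num)
  exact this _ _

theorem fderiv_eq_sum {N : ℕ} (g : (Fin N → ℝ) → ℝ) (y v : Fin N → ℝ) :
    fderiv ℝ g y v = ∑ k, pd k g y * v k := by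
  have hv : v = ∑ k, v k • (Pi.single k 1 : Fin N → ℝ) := by
    ext l
    simp [Finset.sum_apply, Pi.single_apply]
  conv_lhs => rw [hv]
  rw [map_sum]
  refine Finset.sum_congr rfl fun k _ => ?_
  rw [map_smul, smul_eq_mul, mul_comm]
  rfl

theorem chain {N : ℕ} (g : (Fin N → ℝ) → ℝ) (hg : Differentiable ℝ g) (γ : ℝ → Fin N → ℝ)
    (v : Fin N → ℝ) (t : ℝ) (hγ : HasDerivAt γ v t) :
    HasDerivAt (fun s => g (γ s)) (∑ k, pd k g (γ t) * v k) t := by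
  rw [← fderiv_eq_sum]
  exact (hg (γ t)).hasFDerivAt.comp_hasDerivAt t hγ

theorem dom {N : ℕ} (J : Fin N → Fin N → ℝ) (κ E e r : ℝ) (i : Fin N) (v : Fin N → ℝ)
    (he : 0 ≤ e) (heN : N * e = E) (hκ : 1 < κ - E)
    (hd : ∀ j, j ≠ i → κ ≤ |J j j|) (ho : ∀ j k, j ≠ i → k ≠ j → |J j k| ≤ e)
    (hr : ∀ j, j ≠ i → |∑ k, J j k * v k| ≤ r) :
    ∀ j, j ≠ i → |v j| ≤ r + e * |v i| := by
  intro j hj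
  obtain ⟨m, hm, hmax⟩ := Finset.exists_max_image (Finset.univ.erase i) (fun k => |v k|)
    ⟨j, by simp [hj]⟩
  have hmi : m ≠ i := by simpa using hm
  have h1 : J m m * v m = (∑ k, J m k * v k) - ∑ k, if k = m then 0 else J m k * v k := by
    rw [← Finset.sum_sub_distrib]
    rw [Finset.sum_eq_single m] <;> simp +contextual
  have h2 : |∑ k, if k = m then 0 else J m k * v k|
      ≤ ∑ k, (e * |v m| + if k = i then e * |v i| else 0) := by
    refine (Finset.abs_sum_le_sum_abs _ _).trans (Finset.sum_le_sum fun k _ => ?_)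
    have : 0 ≤ e * |v m| := by positivity
    have : 0 ≤ e * |v i| := by positivity
    by_cases hk : k = m
    · subst hk; simp [hmi]; positivity
    · rw [if_neg hk, abs_mul]
      have h3 := ho m k hmi hk
      have h4 : |J m k| * |v k| ≤ e * |v k| := by gcongr
      by_cases hki : k = i
      · subst hki; simp; linarith
      · simp [hki]
        have := hmax k (by simp [hki])
        have : e * |v k| ≤ e * |v m| := by gcongr
        linarith
  have h5 : ∑ k, (e * |v m| + if k = i then e * |v i| else 0) = E * |v m| + e * |v i| := by
    rw [Finset.sum_add_distrib]
    simp [← heN]; ring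
  have h6 : κ * |v m| ≤ r + (E * |v m| + e * |v i|) := by
    calc κ * |v m| ≤ |J m m| * |v m| := by gcongr; exact hd m hmi
      _ = |J m m * v m| := (abs_mul _ _).symm
      _ ≤ _ := by
        rw [h1]
        refine (abs_sub _ _).trans ?_
        have := hr m hmi
        linarith
  have h7 : |v m| ≤ (κ - E) * |v m| := by nlinarith [abs_nonneg (v m)]
  have h8 := hmax j (by simp [hj])
  linarith

/-- linear sum bound -/
theorem lin {N : ℕ} (E e R : ℝ) (i : Fin N) (b v : Fin N → ℝ) (he : 0 ≤ e) (heN : N * e = E)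
    (hb : ∀ k, k ≠ i → |b k| ≤ e) (hv : ∀ k, k ≠ i → |v k| ≤ R) (hR : 0 ≤ R) :
    |∑ k, b k * v k - b i * v i| ≤ E * R := by
  have h1 : ∑ k, b k * v k - b i * v i = ∑ k, if k = i then 0 else b k * v k := by
    have : b i * v i = ∑ k, if k = i then b i * v i else 0 := by simp
    rw [this, ← Finset.sum_sub_distrib]
    refine Finset.sum_congr rfl fun k _ => ?_
    by_cases hk : k = i <;> simp [hk]
  rw [h1]
  refine (Finset.abs_sum_le_sum_abs _ _).trans ?_
  calc _ ≤ ∑ k : Fin N, e * R := by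
        refine Finset.sum_le_sum fun k _ => ?_
        by_cases hk : k = i
        · simp [hk]; positivity
        · rw [if_neg hk, abs_mul]
          have := hb k hk
          have := hv k hk
          gcongr
    _ = E * R := by simp [← heN]; ring

/-- quadratic sum bound -/
theorem quad {N : ℕ} (E e : ℝ) (i p : Fin N) (A : Fin N → Fin N → ℝ) (v : Fin N → ℝ)
    (he : 0 ≤ e) (heN : N * e = E)
    (hA : ∀ k l, ¬ (k = p ∧ l = p) → |A k l| ≤ e) (hv : ∀ k, k ≠ i → |v k| ≤ e) (hvi : v i = 1) :
    |∑ k, (∑ l, A k l * v l) * v k - A p p * v p * v p| ≤ e * (1 + E) ^ 2 := by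
  have hs : ∑ k, |v k| ≤ 1 + E := by
    calc ∑ k, |v k| ≤ ∑ k, (e + if k = i then 1 else 0) := by
          refine Finset.sum_le_sum fun k _ => ?_
          by_cases hk : k = i
          · simp [hk, hvi, he]
          · simpa [hk] using hv k hk
      _ = 1 + E := by rw [Finset.sum_add_distrib]; simp [← heN]; ring
  have hs0 : 0 ≤ ∑ k, |v k| := Finset.sum_nonneg fun k _ => abs_nonneg _
  have h1 : ∑ k, (∑ l, A k l * v l) * v k - A p p * v p * v p
      = ∑ k, ∑ l, if k = p ∧ l = p then 0 else A k l * v l * v k := by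
    have : A p p * v p * v p = ∑ k, ∑ l, if k = p ∧ l = p then A p p * v p * v p else 0 := by
      rw [Finset.sum_eq_single p]
      · simp
      · intro b _ hb; simp [hb]
      · simp
    rw [this, ← Finset.sum_sub_distrib]
    refine Finset.sum_congr rfl fun k _ => ?_
    rw [Finset.sum_mul, ← Finset.sum_sub_distrib]
    refine Finset.sum_congr rfl fun l _ => ?_
    by_cases h : k = p ∧ l = p
    · obtain ⟨rfl, rfl⟩ := h; simp
    · simp [h]
  rw [h1]
  calc _ ≤ ∑ k, ∑ l, e * |v l| * |v k| := by
        refine (Finset.abs_sum_le_sum_abs _ _).trans (Finset.sum_le_sum fun k _ => ?_)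
        refine (Finset.abs_sum_le_sum_abs _ _).trans (Finset.sum_le_sum fun l _ => ?_)
        by_cases h : k = p ∧ l = p
        · rw [if_pos h, abs_zero]; positivity
        · rw [if_neg h, abs_mul, abs_mul]
          have := hA k l h
          gcongr
    _ = e * (∑ k, |v k|) ^ 2 := by
        rw [sq, Finset.sum_mul_sum, Finset.mul_sum]
        refine Finset.sum_congr rfl fun k _ => ?_
        rw [Finset.mul_sum]
        refine Finset.sum_congr rfl fun l _ => ?_
        ring
    _ ≤ _ := by gcongr

/-- mean value bound -/
theorem mvt {N : ℕ} (E e R : ℝ) (i : Fin N) (f : (Fin N → ℝ) → ℝ) (hf : ContDiff ℝ 1 f)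
    (he : 0 ≤ e) (heN : N * e = E) (hb : ∀ k, k ≠ i → ∀ x, |pd k f x| ≤ e)
    (u w : Fin N → ℝ) (hi : u i = w i) (hR : 0 ≤ R) (hk : ∀ k, k ≠ i → |u k - w k| ≤ R) :
    |f u - f w| ≤ E * R := by
  have hline : ∀ τ : ℝ, HasDerivAt (fun τ : ℝ => w + τ • (u - w)) (u - w) τ := by
    intro τ
    have := ((hasDerivAt_id τ).smul_const (u - w)).const_add w
    simpa using this
  have hd := fun τ => chain f (hf.differentiable (by norm_num)) _ _ τ (hline τ)
  have := norm_image_sub_le_of_norm_deriv_le_segment_01' (C := E * R)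
    (fun τ _ => (hd τ).hasDerivWithinAt) (fun τ _ => by
      have := lin E e R i (fun k => pd k f (w + τ • (u - w))) (u - w) he heN
        (fun k hk => hb k hk _) (fun k h => hk k h) hR
      simpa [hi] using this)
  simpa using this

/-- integer valued continuous functions are constant -/
theorem const_of_circle (f : ℝ → ℝ) (hf : Continuous f) (c : 𝕋) (h : ∀ s, (f s : 𝕋) = c) (s t : ℝ) :
    f s = f t := by
  have hz : ∀ s, ∃ n : ℤ, f s - f t = n := by
    intro s
    have h0 : ((f s - f t : ℝ) : 𝕋) = 0 := by
      rw [AddCircle.coe_sub, h, h, sub_self]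
    obtain ⟨n, hn⟩ := (AddCircle.coe_eq_zero_iff (1 : ℝ)).1 h0
    exact ⟨n, by rw [← hn]; simp⟩
  by_contra hne
  have h1 : f s - f t ≠ 0 := sub_ne_zero.2 hne
  obtain ⟨n, hn⟩ := hz s
  have hc : Continuous fun r => f r - f t := hf.sub continuous_const
  have hconn : IsPreconnected (Set.range fun r => f r - f t) := isPreconnected_range hc
  have hoc := hconn.ordConnected
  have hn0 : n ≠ 0 := by rintro rfl; simp at hn; exact h1 (by simpa using hn)
  have mem0 : (0:ℝ) ∈ Set.range fun r => f r - f t := ⟨t, by simp⟩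
  have memn : (n:ℝ) ∈ Set.range fun r => f r - f t := ⟨s, hn⟩
  rcases lt_or_gt_of_ne hn0 with h | h
  · have hle : (n:ℝ) ≤ -1 := by exact_mod_cast (by omega : n ≤ -1)
    obtain ⟨r, hr⟩ := hoc.out memn mem0 (show (-1/2:ℝ) ∈ Set.Icc (n:ℝ) 0 by
      constructor <;> linarith)
    obtain ⟨m, hm⟩ := hz r
    have : (2 * m : ℝ) = -1 := by simp only at hr; linarith
    have : 2 * m = -1 := by exact_mod_cast this
    omega
  · have hle : (1:ℝ) ≤ n := by exact_mod_cast (by omega : 1 ≤ n)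
    obtain ⟨r, hr⟩ := hoc.out mem0 memn (show (1/2:ℝ) ∈ Set.Icc (0:ℝ) n by
      constructor <;> linarith)
    obtain ⟨m, hm⟩ := hz r
    have : (2 * m : ℝ) = 1 := by simp only at hr; linarith
    have : 2 * m = 1 := by exact_mod_cast this
    omega

theorem curve_C2 {N : ℕ} (κ E : ℝ) (HL : (Fin N → ℝ) → Fin N → ℝ) (h1 : AssumptionH1 κ E HL)
    (hE : 0 < E) (h3 : ContDiff ℝ 3 HL) (i : Fin N) (γ : ℝ → Fin N → ℝ) (hγ : ContDiff ℝ 1 γ)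
    (hγi : ∀ s, γ s i = s) (c : Fin N → ℝ) (hc : ∀ j, j ≠ i → ∀ s, HL (γ s) j = c j) :
    Differentiable ℝ (deriv γ) := by
  obtain ⟨hκ, -, hdiag, hoff⟩ := h1
  have hN : (0:ℝ) < N := by exact_mod_cast i.pos
  have hcomp : ∀ j, ContDiff ℝ 3 (fun y => HL y j) := fun j => contDiff_pi.1 h3 j
  set P : (Fin N → ℝ) → Fin N → ℝ := fun y j => if j = i then y i else HL y j with hP
  have hPd : ContDiff ℝ 3 P := by
    rw [contDiff_pi]
    intro j
    by_cases hj : j = i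
    · simp only [hP, hj, if_true]; fun_prop
    · simp only [hP, hj, if_false]; exact hcomp j
  have hPdiff : Differentiable ℝ P := hPd.differentiable (by norm_num)
  have hγd : Differentiable ℝ γ := hγ.differentiable (by norm_num)
  have hfP : ∀ y v j, fderiv ℝ P y v j = fderiv ℝ (fun y => P y j) y v := by
    intro y v j
    rw [fderiv_apply (hPdiff y)]
    rfl
  have hfPi : ∀ y v, fderiv ℝ P y v i = v i := by
    intro y v
    rw [hfP]
    have : (fun y : Fin N → ℝ => P y i) = (ContinuousLinearMap.proj i : (Fin N → ℝ) →L[ℝ] ℝ) := by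
      ext y; simp [hP]
    rw [this, ContinuousLinearMap.fderiv]
    simp
  have hfPj : ∀ y v j, j ≠ i → fderiv ℝ P y v j = ∑ k, pd k (fun y => HL y j) y * v k := by
    intro y v j hj
    rw [hfP, ← fderiv_eq_sum]
    simp [hP, hj]
  have hinj : ∀ y, Function.Injective (fderiv ℝ P y) := by
    intro y
    rw [injective_iff_map_eq_zero]
    intro v hv
    have hvi : v i = 0 := by rw [← hfPi y v, hv]; rfl
    have := dom (fun j k => pd k (fun y => HL y j) y) κ E (E / N) 0 i v (by positivity)
      (by field_simp) hκ (fun j _ => (hdiag j y).le) (fun j k _ hk => (hoff j k hk y).le)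
      (fun j hj => by rw [← hfPj y v j hj, hv]; simp)
    ext j
    by_cases hj : j = i
    · rw [hj, hvi]; rfl
    · have h := this j hj
      rw [hvi] at h
      simpa using h
  have hinv : ∀ y, ∃ e : (Fin N → ℝ) ≃L[ℝ] (Fin N → ℝ),
      (e : (Fin N → ℝ) →L[ℝ] (Fin N → ℝ)) = fderiv ℝ P y := by
    intro y
    refine ⟨(LinearEquiv.ofInjectiveEndo (fderiv ℝ P y : (Fin N → ℝ) →ₗ[ℝ] (Fin N → ℝ))
      (hinj y)).toContinuousLinearEquiv, ?_⟩
    ext; rfl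
  have hPγ : ∀ s, fderiv ℝ P (γ s) (deriv γ s) = Pi.single i 1 := by
    intro s
    have hd := (hPdiff (γ s)).hasFDerivAt.comp_hasDerivAt s (hγd s).hasDerivAt
    have he : P ∘ γ = fun s j => if j = i then s else c j := by
      ext s j
      by_cases hj : j = i
      · simp [hP, hj, hγi]
      · simp [hP, hj, hc j hj]
    rw [he] at hd
    refine hd.unique ?_
    rw [hasDerivAt_pi]
    intro j
    by_cases hj : j = i
    · subst hj; simpa using hasDerivAt_id' s
    · simpa [hj] using hasDerivAt_const s (c j)
  have hform : deriv γ = fun s => (fderiv ℝ P (γ s)).inverse (Pi.single i 1) := by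
    ext1 s
    obtain ⟨e, he⟩ := hinv (γ s)
    rw [← hPγ s, ← he, ContinuousLinearMap.inverse_equiv]
    simp
  rw [hform]
  intro s
  obtain ⟨e, he⟩ := hinv (γ s)
  have hin : DifferentiableAt ℝ ContinuousLinearMap.inverse (fderiv ℝ P (γ s)) := by
    rw [← he]
    exact (contDiffAt_map_inverse (n := 1) e).differentiableAt (by norm_num)
  have hf : DifferentiableAt ℝ (fun s => fderiv ℝ P (γ s)) s :=
    (((hPd.fderiv_right (m := 2) (by norm_num)).differentiable (by norm_num)) (γ s)).comp s (hγd s)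
  exact (hin.comp s hf).clm_apply (differentiableAt_const _)

/-- the constant bounding the second derivative of the curve -/
def Rc (K E : ℝ) : ℝ := E * (1 + E) ^ 2 + K * E ^ 2

theorem curve_bounds {N : ℕ} (κ K E : ℝ) (HL : (Fin N → ℝ) → Fin N → ℝ)
    (h1 : AssumptionH1 κ E HL) (h2 : AssumptionH2 K E HL)
    (hE : 0 < E) (hK : 0 < K) (i : Fin N) (γ : ℝ → Fin N → ℝ) (hγ : ContDiff ℝ 1 γ)
    (hγi : ∀ s, γ s i = s) (c : Fin N → ℝ) (hc : ∀ j, j ≠ i → ∀ s, HL (γ s) j = c j) (t : ℝ) :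
    deriv γ t i = 1 ∧ (∀ j, j ≠ i → |deriv γ t j| ≤ E / N) ∧
    deriv (deriv γ) t i = 0 ∧ (∀ j, j ≠ i → |deriv (deriv γ) t j| ≤ Rc K E / N) := by
  have hN : (0:ℝ) < N := by exact_mod_cast i.pos
  have hN1 : (1:ℝ) ≤ N := by exact_mod_cast i.pos
  have hC2 := curve_C2 κ E HL h1 hE h2.1 i γ hγ hγi c hc
  obtain ⟨hκ, -, hdiag, hoff⟩ := h1
  obtain ⟨h3, hdd, hoo, -, -, -⟩ := h2
  have hcomp : ∀ j, ContDiff ℝ 3 (fun y => HL y j) := fun j => contDiff_pi.1 h3 j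
  have hγd : Differentiable ℝ γ := hγ.differentiable (by norm_num)
  have hv1 : ∀ s, deriv γ s i = 1 := by
    intro s
    have h := (hasDerivAt_pi.1 (hγd s).hasDerivAt) i
    simp only [hγi] at h
    exact h.unique (hasDerivAt_id s)
  have ha1 : deriv (deriv γ) t i = 0 := by
    have h := (hasDerivAt_pi.1 (hC2 t).hasDerivAt) i
    simp only [hv1] at h
    exact h.unique (hasDerivAt_const t 1)
  have hlin : ∀ j, j ≠ i → ∀ s, ∑ k, pd k (fun y => HL y j) (γ s) * deriv γ s k = 0 := by
    intro j hj s
    have h := chain (fun y => HL y j) ((hcomp j).differentiable (by norm_num)) γ _ s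
      (hγd s).hasDerivAt
    simp only [hc j hj] at h
    exact h.unique (hasDerivAt_const s _)
  have hvb : ∀ j, j ≠ i → |deriv γ t j| ≤ E / N := by
    have := dom (fun j k => pd k (fun y => HL y j) (γ t)) κ E (E / N) 0 i (deriv γ t)
      (by positivity)
      (by field_simp) hκ (fun j _ => (hdiag j _).le) (fun j k _ hk => (hoff j k hk _).le)
      (fun j hj => by rw [hlin j hj]; simp)
    intro j hj
    simpa [hv1] using this j hj
  refine ⟨hv1 t, hvb, ha1, ?_⟩
  have := dom (fun j k => pd k (fun y => HL y j) (γ t)) κ E (E / N) (Rc K E / N) i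
      (deriv (deriv γ) t) (by positivity)
      (by field_simp) hκ (fun j _ => (hdiag j _).le) (fun j k _ hk => (hoff j k hk _).le) ?_
  · intro j hj
    simpa [ha1] using this j hj
  intro j hj
  have hsec := HasDerivAt.fun_sum (u := Finset.univ) (fun k _ =>
    (chain (pd k (fun y => HL y j))
      ((cd_pd _ (hcomp j) (m := 2) (by norm_num) k).differentiable (by norm_num)) γ _ t
      (hγd t).hasDerivAt).mul ((hasDerivAt_pi.1 (hC2 t).hasDerivAt) k))
  have hz : (fun s => ∑ k, pd k (fun y => HL y j) (γ s) * deriv γ s k) = fun _ => 0 := by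
    ext s; exact hlin j hj s
  have hsec' := hsec.unique (hz ▸ hasDerivAt_const t (0:ℝ))
  rw [Finset.sum_add_distrib] at hsec'
  have hq := quad E (E / N) i j (fun k l => pd l (pd k (fun y => HL y j)) (γ t)) (deriv γ t)
    (by positivity) (by field_simp) (by
      intro k l hkl
      by_cases hk : k = j
      · have hl : l ≠ j := fun h => hkl ⟨hk, h⟩
        rw [pd_symm _ (hcomp j)]
        exact hoo j l k hl _
      · exact hoo j k l hk _) hvb (hv1 t)
  have hjj := hdd j (γ t)
  have hvj := hvb j hj
  have hm : |pd j (pd j (fun y => HL y j)) (γ t) * deriv γ t j * deriv γ t j|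
      ≤ K * E ^ 2 / N := by
    rw [abs_mul, abs_mul]
    calc _ ≤ K * (E / N) * (E / N) := by gcongr
      _ = K * E ^ 2 / N / N := by ring
      _ ≤ K * E ^ 2 / N := div_le_self (by positivity) hN1
  have heq : Rc K E / N = E / N * (1 + E) ^ 2 + K * E ^ 2 / N := by unfold Rc; ring
  rw [heq]
  rw [eq_neg_of_add_eq_zero_right hsec', abs_neg]
  have := abs_add_le (∑ k, (∑ l, pd l (pd k (fun y => HL y j)) (γ t) * deriv γ t l) * deriv γ t k
    - pd j (pd j (fun y => HL y j)) (γ t) * deriv γ t j * deriv γ t j)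
    (pd j (pd j (fun y => HL y j)) (γ t) * deriv γ t j * deriv γ t j)
  rw [sub_add_cancel] at this
  linarith

theorem core {N : ℕ} (κ K E : ℝ) (HL : (Fin N → ℝ) → Fin N → ℝ)
    (h1 : AssumptionH1 κ E HL) (h2 : AssumptionH2 K E HL)
    (hE : 0 < E) (hK : 0 < K) (i : Fin N) (γ : ℝ → Fin N → ℝ) (hγ : ContDiff ℝ 1 γ)
    (hγi : ∀ s, γ s i = s) (c : Fin N → ℝ) (hc : ∀ j, j ≠ i → ∀ s, HL (γ s) j = c j)
    (w : Fin N → ℝ) (hw : ∀ k, k ≠ i → ∀ s, |γ s k - w k| ≤ E / N) (t : ℝ) :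
    |HL (γ t) i - HL (Function.update w i t) i| ≤ E * (E / N) ∧
    |deriv (fun s => HL (γ s) i) t - deriv (fun s => HL (Function.update w i s) i) t|
      ≤ E * (E / N) + E * (E / N) ∧
    |deriv (deriv (fun s => HL (γ s) i)) t
      - deriv (deriv (fun s => HL (Function.update w i s) i)) t|
      ≤ E * (Rc K E / N) + E / N * (1 + E) ^ 2 + E * (E / N) := by
  have hN : (0:ℝ) < N := by exact_mod_cast i.pos
  have hC2 := curve_C2 κ E HL h1 hE h2.1 i γ hγ hγi c hc
  have hb := curve_bounds κ K E HL h1 h2 hE hK i γ hγ hγi c hc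
  have hR : 0 ≤ Rc K E := by unfold Rc; positivity
  obtain ⟨hκ, -, hdiag, hoff⟩ := h1
  obtain ⟨h3, hdd, hoo, -, h5, -⟩ := h2
  have hg : ContDiff ℝ 3 (fun y => HL y i) := contDiff_pi.1 h3 i
  have hγd : Differentiable ℝ γ := hγ.differentiable (by norm_num)
  have hpk : ∀ k, ContDiff ℝ 2 (pd k (fun y => HL y i)) := fun k => cd_pd _ hg (by norm_num) k
  have hu : ∀ s, γ s i = Function.update w i s i := by intro s; simp [hγi]
  have hu' : ∀ s k, k ≠ i → |γ s k - Function.update w i s k| ≤ E / N := by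
    intro s k hk
    simpa [hk] using hw k hk s
  -- the coordinate line
  have hline : ∀ s, HasDerivAt (fun s => Function.update w i s) (Pi.single i (1:ℝ)) s := by
    intro s
    exact hasDerivAt_update w i s
  have hL1 : ∀ g : (Fin N → ℝ) → ℝ, Differentiable ℝ g →
      deriv (fun s => g (Function.update w i s)) = fun s => pd i g (Function.update w i s) := by
    intro g hg
    ext s
    rw [(chain g hg _ _ s (hline s)).deriv]
    simp [Pi.single_apply]
  have hG1 : deriv (fun s => HL (γ s) i)
      = fun s => ∑ k, pd k (fun y => HL y i) (γ s) * deriv γ s k := by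
    ext s
    exact (chain (fun y => HL y i) (hg.differentiable (by norm_num)) γ _ s
      (hγd s).hasDerivAt).deriv
  refine ⟨?_, ?_, ?_⟩
  · exact mvt E (E / N) (E / N) i (fun y => HL y i) (hg.of_le (by norm_num)) (by positivity)
      (by field_simp) (fun k hk x => (hoff i k hk x).le) _ _ (hu t) (by positivity) (hu' t)
  · rw [hL1 (fun y => HL y i) (hg.differentiable (by norm_num)), hG1]
    have ha := lin E (E / N) (E / N) i (fun k => pd k (fun y => HL y i) (γ t)) (deriv γ t)
      (by positivity) (by field_simp) (fun k hk => (hoff i k hk _).le) (hb t).2.1 (by positivity)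
    have hm := mvt E (E / N) (E / N) i (pd i (fun y => HL y i)) ((hpk i).of_le (by norm_num))
      (by positivity) (by field_simp)
      (fun k hk x => by rw [pd_symm _ hg]; exact hoo i k i hk x) _ _ (hu t) (by positivity) (hu' t)
    simp only [(hb t).1, mul_one] at ha
    exact (abs_sub_le _ _ _).trans (add_le_add ha hm)
  · rw [hL1 (fun y => HL y i) (hg.differentiable (by norm_num)),
      hL1 (pd i fun y => HL y i) ((hpk i).differentiable (by norm_num)), hG1]
    have hsec := HasDerivAt.fun_sum (u := Finset.univ) (fun k _ =>
      (chain (pd k (fun y => HL y i)) ((hpk k).differentiable (by norm_num)) γ _ t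
        (hγd t).hasDerivAt).mul ((hasDerivAt_pi.1 (hC2 t).hasDerivAt) k))
    have hsec' := hsec.deriv
    rw [Finset.sum_add_distrib] at hsec'
    have hq := quad E (E / N) i i (fun k l => pd l (pd k (fun y => HL y i)) (γ t)) (deriv γ t)
      (by positivity) (by field_simp) (by
        intro k l hkl
        by_cases hk : k = i
        · have hl : l ≠ i := fun h => hkl ⟨hk, h⟩
          rw [pd_symm _ hg]
          exact hoo i l k hl _
        · exact hoo i k l hk _) (hb t).2.1 (hb t).1
    have ha := lin E (E / N) (Rc K E / N) i (fun k => pd k (fun y => HL y i) (γ t))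
      (deriv (deriv γ) t)
      (by positivity) (by field_simp) (fun k hk => (hoff i k hk _).le) (hb t).2.2.2 (by positivity)
    have hm := mvt E (E / N) (E / N) i (pd i (pd i (fun y => HL y i)))
      (cd_pd _ (hpk i) (by norm_num) i)
      (by positivity) (by field_simp)
      (fun k hk x => h5 i k hk x) _ _ (hu t) (by positivity) (hu' t)
    simp only [(hb t).1, (hb t).2.2.1, mul_one, mul_zero, sub_zero] at ha hq
    refine (congrArg (fun z => |z - _|) hsec').trans_le ?_
    rw [abs_le] at *
    constructor <;> linarith [ha.1, ha.2, hq.1, hq.2, hm.1, hm.2]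

end GiAux

/-- `G_i(·;x̂_i)` is `C²`-close to `H_i(·;x̂_i)`. -/
theorem Gi_close_to_Hi :
    ∀ κ K E : ℝ, 0 < E → 1 < κ - E → 0 < K →
    ∃ C : ℝ, 0 < C ∧ ∃ N₀ : ℕ, ∀ N : ℕ, N₀ ≤ N →
      ∀ (H : (Fin N → 𝕋) → Fin N → 𝕋) (HL : (Fin N → ℝ) → Fin N → ℝ),
        IsLiftMap HL H → AssumptionH1 κ E HL → AssumptionH2 K E HL →
        ∀ i : Fin N, ∀ (Φ : (Fin N → 𝕋) → Fin N → 𝕋) (ΦL : (Fin N → ℝ) → Fin N → ℝ),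
          IsStraightening i H Φ ΦL →
          ∀ (x : Fin N → ℝ) (t : ℝ),
            dist ((HL (ΦL (Function.update x i t)) i : ℝ) : 𝕋)
                 ((HL (Function.update x i t) i : ℝ) : 𝕋) ≤ C / (N : ℝ) ∧
            |deriv (fun s => HL (ΦL (Function.update x i s)) i) t
              - deriv (fun s => HL (Function.update x i s) i) t| ≤ C / (N : ℝ) ∧
            |deriv (deriv (fun s => HL (ΦL (Function.update x i s)) i)) t
              - deriv (deriv (fun s => HL (Function.update x i s) i)) t| ≤ C / (N : ℝ) := by
  intro κ K E hE hκ hK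
  have hR : 0 ≤ GiAux.Rc K E := by unfold GiAux.Rc; positivity
  refine ⟨2 * E * E + E * GiAux.Rc K E + E * (1 + E) ^ 2, by positivity, ⌈E⌉₊ + 1, ?_⟩
  intro N hN0 H HL hHL h1 h2 i Φ ΦL hΦ x t
  have hN : (0:ℝ) < N := by exact_mod_cast i.pos
  have hEN : E / N < 1 := by
    rw [div_lt_one hN]
    calc E ≤ (⌈E⌉₊ : ℝ) := Nat.le_ceil E
      _ < (⌈E⌉₊ + 1 : ℕ) := by push_cast; linarith
      _ ≤ N := by exact_mod_cast hN0
  obtain ⟨-, -, hΦL, hlift, -, hΦi, hHΦ, hΦ0⟩ := hΦ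
  set γ : ℝ → Fin N → ℝ := fun s => ΦL (Function.update x i s) with hγdef
  have hupd : ContDiff ℝ 1 (fun s : ℝ => Function.update x i s) := contDiff_update 1 x i
  have hγ : ContDiff ℝ 1 γ := hΦL.comp hupd
  have hγi : ∀ s, γ s i = s := by intro s; simp [hγdef, hΦi]
  have hγd : Differentiable ℝ γ := hγ.differentiable (by norm_num)
  have hproj : ∀ s : ℝ, (fun k => ((Function.update x i s k : ℝ) : 𝕋))
      = Function.update (fun k => ((x k : ℝ) : 𝕋)) i (s : 𝕋) := by
    intro s
    ext k
    by_cases hk : k = i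
    · subst hk; simp
    · simp [hk]
  have hγproj : ∀ s k, ((γ s k : ℝ) : 𝕋)
      = Φ (Function.update (fun k => ((x k : ℝ) : 𝕋)) i (s : 𝕋)) k := by
    intro s k
    rw [← hproj, hlift]
  have hcont : ∀ j, Continuous (fun y => HL y j) := fun j =>
    (continuous_apply j).comp h2.1.continuous
  have hc : ∀ j, j ≠ i → ∀ s, HL (γ s) j = HL (γ 0) j := by
    intro j hj s
    refine GiAux.const_of_circle (fun s => HL (γ s) j) ((hcont j).comp hγ.continuous)
      (H (Function.update (fun k => ((x k : ℝ) : 𝕋)) i 0) j) ?_ s 0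
    intro r
    have e1 := congrFun (hHL (γ r)) j
    have e2 : (fun k => ((γ r k : ℝ) : 𝕋))
        = Φ (Function.update (fun k => ((x k : ℝ) : 𝕋)) i (r : 𝕋)) := by
      ext k; exact hγproj r k
    rw [e2, hHΦ _ j hj] at e1
    rw [← e1]
    simp
  have hb := GiAux.curve_bounds κ K E HL h1 h2 hE hK i γ hγ hγi _ hc
  have hlip : ∀ k, k ≠ i → ∀ r s, |γ r k - γ s k| ≤ E / N * |r - s| := by
    intro k hk r s
    have hd : ∀ r, HasDerivAt (fun r => γ r k) (deriv γ r k) r := fun r =>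
      (hasDerivAt_pi.1 (hγd r).hasDerivAt) k
    exact Convex.norm_image_sub_le_of_norm_hasDerivWithin_le (s := Set.univ)
      (fun r _ => (hd r).hasDerivWithinAt) (fun r _ => (hb r).2.1 k hk) convex_univ
      (Set.mem_univ s) (Set.mem_univ r)
  have hper : ∀ k, k ≠ i → Function.Periodic (fun s => γ s k) 1 := by
    intro k hk s
    have h0 : ((γ (s + 1) k - γ s k : ℝ) : 𝕋) = 0 := by
      rw [AddCircle.coe_sub, hγproj, hγproj, AddCircle.coe_add_period, sub_self]
    obtain ⟨n, hn⟩ := (AddCircle.coe_eq_zero_iff (1 : ℝ)).1 h0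
    have hl := hlip k hk (s + 1) s
    rw [← hn] at hl
    simp at hl
    have : |(n:ℝ)| < 1 := lt_of_le_of_lt hl hEN
    have : |n| < 1 := by exact_mod_cast this
    have hn0 : n = 0 := Int.abs_lt_one_iff.1 this
    rw [hn0] at hn
    simp at hn
    simp only
    linarith
  have hw : ∀ k, k ≠ i → ∀ s, |γ s k - γ 0 k| ≤ E / N := by
    intro k hk s
    obtain ⟨r, hr, hrs⟩ := (hper k hk).exists_mem_Ico₀ one_pos s
    rw [hrs]
    refine (hlip k hk r 0).trans ?_
    have : |r - 0| ≤ 1 := by rw [sub_zero, abs_of_nonneg hr.1]; exact hr.2.le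
    exact mul_le_of_le_one_right (by positivity) this
  obtain ⟨c0, c1, c2⟩ := GiAux.core κ K E HL h1 h2 hE hK i γ hγ hγi _ hc (γ 0) hw t
  have hsame : ∀ s : ℝ, ((HL (Function.update (γ 0) i s) i : ℝ) : 𝕋)
      = ((HL (Function.update x i s) i : ℝ) : 𝕋) := by
    intro s
    have e1 := congrFun (hHL (Function.update (γ 0) i s)) i
    have e2 := congrFun (hHL (Function.update x i s)) i
    rw [← e1, ← e2]
    congr 1
    congr 1
    ext k
    by_cases hk : k = i
    · subst hk; simp
    · have := hγproj 0 k
      rw [show ((0:ℝ) : 𝕋) = 0 from rfl, hΦ0] at this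
      simpa [hk] using this
  have hconst : ∀ s, HL (Function.update (γ 0) i s) i
      = HL (Function.update x i s) i
        + (HL (Function.update (γ 0) i 0) i - HL (Function.update x i 0) i) := by
    intro s
    have := GiAux.const_of_circle
      (fun s => HL (Function.update (γ 0) i s) i - HL (Function.update x i s) i)
      (((hcont i).comp (contDiff_update (𝕜 := ℝ) 1 (γ 0) i).continuous).sub
        ((hcont i).comp hupd.continuous)) 0
      (fun r => by rw [AddCircle.coe_sub, hsame, sub_self]) s 0
    linarith
  have hder : deriv (fun s => HL (Function.update (γ 0) i s) i)
      = deriv (fun s => HL (Function.update x i s) i) := by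
    rw [funext hconst]
    ext s
    rw [deriv_add_const]
  rw [hder] at c1 c2
  have hE2 : 0 ≤ E * E / N := by positivity
  have hE3 : 0 ≤ E * GiAux.Rc K E / N := by positivity
  have hE4 : 0 ≤ E * (1 + E) ^ 2 / N := by positivity
  have hC : (2 * E * E + E * GiAux.Rc K E + E * (1 + E) ^ 2) / N
      = 2 * (E * E / N) + E * GiAux.Rc K E / N + E * (1 + E) ^ 2 / N := by ring
  rw [hC]
  refine ⟨?_, c1.trans ?_, c2.trans ?_⟩
  · rw [← hsame, dist_eq_norm, ← AddCircle.coe_sub]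
    have hn : ‖((HL (γ t) i - HL (Function.update (γ 0) i t) i : ℝ) : 𝕋)‖
        ≤ |HL (γ t) i - HL (Function.update (γ 0) i t) i| :=
      QuotientAddGroup.norm_mk_le_norm
    refine (hn.trans c0).trans ?_
    rw [← mul_div_assoc]
    linarith
  · rw [← mul_div_assoc]
    linarith
  · rw [← mul_div_assoc, ← mul_div_assoc, div_mul_eq_mul_div]
    linarith
end
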